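/- arXiv:2210.17006 — 2 statements merged into one kernel-verified Lean document; each statement's English description precedes it below -/
import Mathlib

section
/- Let t > 0, let G be a 2-connected t-tough graph of order n, and let s ≥ 1 be an integer such that G has a D_{s+1}-cycle but no D_s-cycle. Let C be a D_{s+1}-cycle of G chosen among all D_{s+1}-cycles so that the tuple (c_s(G−V(C)), c_{s−1}(G−V(C)), …, c₁(G−V(C))) is lexicographically minimal, i.e., C minimizes c_p(G−V(C)) prior to minimizing c_q(G−V(C)) for all p,q ∈ [1,s] with p > q. Then n ≥ (t + |V(H)|)·(d_G(H) + 1) for every connected component H of G − V(C). -/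
open SimpleGraph

/-- The number of connected components of `G − S`, the subgraph of `G` induced on the
complement of the vertex set `S`. -/
noncomputable def numComp {V : Type*} (G : SimpleGraph V) (S : Set V) : ℕ :=
  Nat.card (G.induce Sᶜ).ConnectedComponent

/-- A graph `G` is `t`-tough if `|S| ≥ t · c(G − S)` for every vertex set `S` whose removal
leaves at least two components. -/
def Tough {V : Type*} [Fintype V] (t : ℝ) (G : SimpleGraph V) : Prop :=
  ∀ S : Finset V, 2 ≤ numComp G (S : Set V) →
    t * (numComp G (S : Set V) : ℝ) ≤ (S.card : ℝ)

/-- A cycle `C` of `G` is a `D_λ`-cycle if every connected component of `G − V(C)` has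
fewer than `λ` vertices. -/
def IsDCycle {V : Type*} (G : SimpleGraph V) {v : V} (C : G.Walk v v) (lam : ℕ) : Prop :=
  C.IsCycle ∧
    ∀ c : (G.induce {x : V | x ∈ C.support}ᶜ).ConnectedComponent, Nat.card c.supp < lam

/-- `c_p(G − S)`: the number of connected components of `G − S` having at least `p`
vertices. -/
noncomputable def numCompGe {V : Type*} (G : SimpleGraph V) (S : Set V) (p : ℕ) : ℕ :=
  Nat.card {c : (G.induce Sᶜ).ConnectedComponent // p ≤ Nat.card c.supp}

section ToughCycles

variable {V : Type*} {G : SimpleGraph V}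

/-- `a` and `b` are joined by a walk of `G` that avoids `T`. -/
def ConnAvoiding (G : SimpleGraph V) (T : Set V) (a b : V) : Prop :=
  ∃ p : G.Walk a b, ∀ x ∈ p.support, x ∉ T

/-- The vertices that can be reached from `z` by a walk avoiding `T`. -/
def compOf (G : SimpleGraph V) (T : Set V) (z : V) : Set V :=
  {w | ConnAvoiding G T z w}

/-- The vertex sets of the connected components of `G − T`. -/
def comps (G : SimpleGraph V) (T : Set V) : Set (Set V) :=
  {K | ∃ z, z ∉ T ∧ K = compOf G T z}

/-- The vertices outside `H` having a neighbour in `H`. -/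
def outerBoundary (G : SimpleGraph V) (H : Set V) : Set V :=
  {x | x ∉ H ∧ ∃ y ∈ H, G.Adj x y}

namespace ConnAvoiding

variable {T T' : Set V} {a b c : V}

theorem refl (ha : a ∉ T) : ConnAvoiding G T a a :=
  ⟨Walk.nil, by simpa using ha⟩

theorem symm (h : ConnAvoiding G T a b) : ConnAvoiding G T b a := by
  obtain ⟨p, hp⟩ := h
  exact ⟨p.reverse, by simpa using hp⟩

theorem trans (h : ConnAvoiding G T a b) (h' : ConnAvoiding G T b c) : ConnAvoiding G T a c := by
  obtain ⟨p, hp⟩ := h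
  obtain ⟨q, hq⟩ := h'
  refine ⟨p.append q, fun x hx => ?_⟩
  rcases (Walk.mem_support_append_iff p q).1 hx with h | h
  exacts [hp x h, hq x h]

theorem mono (hT : T' ⊆ T) (h : ConnAvoiding G T a b) : ConnAvoiding G T' a b := by
  obtain ⟨p, hp⟩ := h
  exact ⟨p, fun x hx hx' => hp x hx (hT hx')⟩

theorem left_notMem (h : ConnAvoiding G T a b) : a ∉ T := by
  obtain ⟨p, hp⟩ := h
  exact hp a p.start_mem_support

theorem right_notMem (h : ConnAvoiding G T a b) : b ∉ T := h.symm.left_notMem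

theorem of_adj (hab : G.Adj a b) (ha : a ∉ T) (hb : b ∉ T) : ConnAvoiding G T a b :=
  ⟨Walk.cons hab Walk.nil, by simp [ha, hb]⟩

theorem of_mem_support {p : G.Walk a b} (hp : ∀ x ∈ p.support, x ∉ T) (hc : c ∈ p.support) :
    ConnAvoiding G T a c := by
  classical
  exact ⟨p.takeUntil c hc, fun x hx => hp x (p.support_takeUntil_subset_support hc hx)⟩

theorem compOf_eq (h : ConnAvoiding G T a b) : compOf G T a = compOf G T b := by
  ext w
  exact ⟨fun hw => h.symm.trans hw, fun hw => h.trans hw⟩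

end ConnAvoiding

theorem connAvoiding_iff_reachable {T : Set V} {a b : V} (ha : a ∉ T) (hb : b ∉ T) :
    ConnAvoiding G T a b ↔ (G.induce Tᶜ).Reachable ⟨a, ha⟩ ⟨b, hb⟩ := by
  constructor
  · rintro ⟨p, hp⟩
    exact ⟨p.induce Tᶜ hp⟩
  · rintro ⟨p⟩
    refine ⟨p.map (Embedding.induce Tᶜ).toHom, fun x hx => ?_⟩
    obtain ⟨y, -, rfl⟩ := List.mem_map.1 (by rw [← Walk.support_map]; exact hx)
    exact y.2

theorem coe_image_supp_mk {T : Set V} {z : V} (hz : z ∉ T) :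
    Subtype.val '' ((G.induce Tᶜ).connectedComponentMk ⟨z, hz⟩).supp = compOf G T z := by
  ext w
  constructor
  · rintro ⟨⟨w, hw⟩, hw', rfl⟩
    rw [ConnectedComponent.mem_supp_iff, ConnectedComponent.eq] at hw'
    exact ((connAvoiding_iff_reachable hw hz).2 hw').symm
  · intro hw
    refine ⟨⟨w, ConnAvoiding.right_notMem hw⟩, ?_, rfl⟩
    rw [ConnectedComponent.mem_supp_iff, ConnectedComponent.eq]
    exact (connAvoiding_iff_reachable _ hz).1 (ConnAvoiding.symm hw)

theorem coe_image_supp_mem_comps {T : Set V} (c : (G.induce Tᶜ).ConnectedComponent) :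
    Subtype.val '' c.supp ∈ comps G T := by
  induction c using ConnectedComponent.ind with
  | h z => exact ⟨z.1, z.2, coe_image_supp_mk z.2⟩

theorem card_supp_eq_ncard_image {T : Set V} (c : (G.induce Tᶜ).ConnectedComponent) :
    Nat.card c.supp = (Subtype.val '' c.supp).ncard := by
  rw [Set.ncard_image_of_injective _ Subtype.val_injective, Nat.card_coe_set_eq]

theorem numCompGe_eq_ncard (T : Set V) (p : ℕ) :
    numCompGe G T p = {K | K ∈ comps G T ∧ p ≤ K.ncard}.ncard := by
  have himg : {K | K ∈ comps G T ∧ p ≤ K.ncard} =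
      (fun c : (G.induce Tᶜ).ConnectedComponent => Subtype.val '' c.supp) ''
        {c | p ≤ Nat.card c.supp} := by
    ext K
    constructor
    · rintro ⟨⟨z, hz, rfl⟩, hp⟩
      refine ⟨(G.induce Tᶜ).connectedComponentMk ⟨z, hz⟩, ?_, coe_image_supp_mk hz⟩
      rwa [Set.mem_ofPred_eq, card_supp_eq_ncard_image, coe_image_supp_mk hz]
    · rintro ⟨c, hc, rfl⟩
      refine ⟨coe_image_supp_mem_comps c, ?_⟩
      rw [Set.mem_ofPred_eq, card_supp_eq_ncard_image] at hc
      exact hc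
  have hinj : Function.Injective
      (fun c : (G.induce Tᶜ).ConnectedComponent => Subtype.val '' c.supp) :=
    Subtype.val_injective.image_injective.comp ConnectedComponent.supp_injective
  rw [himg, Set.ncard_image_of_injective _ hinj]
  exact Nat.card_coe_set_eq _

theorem mem_comps_of_mem {T K : Set V} {x : V} (hK : K ∈ comps G T) (hx : x ∈ K) :
    x ∉ T ∧ K = compOf G T x := by
  obtain ⟨z, -, rfl⟩ := hK
  exact ⟨ConnAvoiding.right_notMem hx, ConnAvoiding.compOf_eq hx⟩

theorem outerBoundary_subset_of_mem_comps {T K : Set V} (hK : K ∈ comps G T) :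
    outerBoundary G K ⊆ T := by
  rintro x ⟨hxK, y, hy, hxy⟩
  by_contra hx
  obtain ⟨hyT, rfl⟩ := mem_comps_of_mem hK hy
  exact hxK (ConnAvoiding.of_adj hxy.symm hyT hx)

/-- A walk leaving `H` meets the outer boundary of `H`. -/
theorem exists_mem_support_outerBoundary {H : Set V} {a b : V} (p : G.Walk a b) (ha : a ∈ H)
    (hb : b ∉ H) : ∃ x ∈ p.support, x ∈ outerBoundary G H := by
  induction p with
  | nil => exact absurd ha hb
  | @cons u v w h p ih =>
    by_cases hv : v ∈ H
    · obtain ⟨x, hx, hx'⟩ := ih hv hb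
      exact ⟨x, by simp [hx], hx'⟩
    · exact ⟨v, by simp, hv, u, ha, h.symm⟩

/-- A walk that starts in `H` and avoids the outer boundary of `H` stays in `H`. -/
theorem ConnAvoiding.mem_of_outerBoundary_subset {H S : Set V} {a b : V}
    (h : ConnAvoiding G S a b) (ha : a ∈ H) (hS : outerBoundary G H ⊆ S) : b ∈ H := by
  obtain ⟨p, hp⟩ := h
  by_contra hb
  obtain ⟨x, hx, hxB⟩ := exists_mem_support_outerBoundary p ha hb
  exact hp x hx (hS hxB)

/-- If a cycle `C'` meets a component `H` of `G − V(C)`, where `C` is lexicographically minimal,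
then some component of `G − V(C')` that meets `C` is at least as large as `H`. -/
theorem exists_large_component_of_lexmin [Finite V] {s : ℕ} {v : V} (C : G.Walk v v)
    (hC : IsDCycle G C (s + 1))
    (hlexmin : ∀ (w : V) (C' : G.Walk w w), IsDCycle G C' (s + 1) →
      ∀ p : ℕ, 1 ≤ p → p ≤ s →
        (∀ q : ℕ, p < q → q ≤ s →
          numCompGe G {x : V | x ∈ C'.support} q = numCompGe G {x : V | x ∈ C.support} q) →
        numCompGe G {x : V | x ∈ C.support} p ≤ numCompGe G {x : V | x ∈ C'.support} p)
    {H : Set V} (hH : H ∈ comps G {x | x ∈ C.support}) {w : V} (C' : G.Walk w w)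
    (hC' : C'.IsCycle) (hHC' : ∃ x ∈ H, x ∈ C'.support) :
    ∃ z ∈ C.support, z ∉ C'.support ∧
      H.ncard ≤ (compOf G {x | x ∈ C'.support} z).ncard := by
  by_contra! hsmall
  have hcard : ∀ K ∈ comps G {x | x ∈ C.support}, K.ncard ≤ s := by
    rintro K ⟨z, hz, rfl⟩
    have := hC.2 ((G.induce {x : V | x ∈ C.support}ᶜ).connectedComponentMk ⟨z, hz⟩)
    rw [card_supp_eq_ncard_image, coe_image_supp_mk hz] at this
    omega
  obtain ⟨E, ⟨hE, e, heE, heC'⟩, hmax⟩ := Set.exists_max_image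
    {K | K ∈ comps G {x | x ∈ C.support} ∧ ∃ x ∈ K, x ∈ C'.support} Set.ncard
    (Set.toFinite _) ⟨H, hH, hHC'⟩
  have hHE : H.ncard ≤ E.ncard := hmax H ⟨hH, hHC'⟩
  have hEpos : 1 ≤ E.ncard := (Set.ncard_pos (Set.toFinite _)).2 ⟨e, heE⟩
  have hEs : E.ncard ≤ s := hcard E hE
  have hkey : ∀ K ∈ comps G {x | x ∈ C'.support}, E.ncard ≤ K.ncard →
      K ∈ comps G {x | x ∈ C.support} ∧ K ≠ E := by
    rintro K ⟨z, hz, rfl⟩ hEK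
    have hdisj : ∀ x, ConnAvoiding G {x | x ∈ C'.support} z x → x ∉ C.support := by
      intro x hx hxC
      have := hsmall x hxC hx.right_notMem
      rw [← hx.compOf_eq] at this
      omega
    have hsub : compOf G {x | x ∈ C'.support} z ⊆ compOf G {x | x ∈ C.support} z := by
      rintro x ⟨p, hp⟩
      exact ⟨p, fun y hy => hdisj y (ConnAvoiding.of_mem_support hp hy)⟩
    have hzz : z ∈ compOf G {x | x ∈ C'.support} z := ConnAvoiding.refl hz
    have hF : compOf G {x | x ∈ C.support} z ∈ comps G {x | x ∈ C.support} :=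
      ⟨z, (hsub hzz).left_notMem, rfl⟩
    have hnot : ∀ x ∈ compOf G {x | x ∈ C.support} z, x ∉ C'.support := by
      intro x hx hxC'
      have h1 := hmax _ ⟨hF, x, hx, hxC'⟩
      have h2 : (compOf G {x | x ∈ C'.support} z).ncard <
          (compOf G {x | x ∈ C.support} z).ncard := by
        refine Set.ncard_lt_ncard ⟨hsub, fun h => ?_⟩ (Set.toFinite _)
        exact ConnAvoiding.right_notMem (h hx) hxC'
      omega
    have heq : compOf G {x | x ∈ C'.support} z = compOf G {x | x ∈ C.support} z := by
      refine hsub.antisymm ?_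
      rintro x ⟨p, hp⟩
      exact ⟨p, fun y hy => hnot y (ConnAvoiding.of_mem_support hp hy)⟩
    rw [heq]
    refine ⟨hF, fun h => hnot e (h ▸ heE) heC'⟩
  have hsubset : ∀ q, E.ncard ≤ q →
      {K | K ∈ comps G {x | x ∈ C'.support} ∧ q ≤ K.ncard} ⊆
        {K | K ∈ comps G {x | x ∈ C.support} ∧ q ≤ K.ncard} :=
    fun q hq K hK => ⟨(hkey K hK.1 (hq.trans hK.2)).1, hK.2⟩
  have hle : ∀ q, E.ncard ≤ q →
      numCompGe G {x | x ∈ C'.support} q ≤ numCompGe G {x | x ∈ C.support} q := by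
    intro q hq
    rw [numCompGe_eq_ncard, numCompGe_eq_ncard]
    exact Set.ncard_le_ncard (hsubset q hq) (Set.toFinite _)
  have hlt : numCompGe G {x | x ∈ C'.support} E.ncard <
      numCompGe G {x | x ∈ C.support} E.ncard := by
    rw [numCompGe_eq_ncard, numCompGe_eq_ncard]
    refine Set.ncard_lt_ncard ⟨hsubset _ le_rfl, fun h => ?_⟩ (Set.toFinite _)
    have hEE := h ⟨hE, le_rfl⟩
    exact (hkey E hEE.1 le_rfl).2 rfl
  have hDC' : IsDCycle G C' (s + 1) := by
    refine ⟨hC', fun c => ?_⟩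
    rw [card_supp_eq_ncard_image, Nat.lt_succ_iff]
    by_cases hc : E.ncard ≤ (Subtype.val '' c.supp).ncard
    · exact hcard _ (hkey _ (coe_image_supp_mem_comps c) hc).1
    · omega
  have heq : ∀ d q, s - q = d → E.ncard < q → q ≤ s →
      numCompGe G {x | x ∈ C'.support} q = numCompGe G {x | x ∈ C.support} q := by
    intro d
    induction d using Nat.strong_induction_on with
    | _ d ih =>
      intro q hd hEq hqs
      refine (hle q hEq.le).antisymm (hlexmin w C' hDC' q (by omega) hqs fun r hr hrs => ?_)
      exact ih (s - r) (by omega) r rfl (by omega) hrs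
  exact absurd (hlexmin w C' hDC' E.ncard hEpos hEs fun q hq hqs => heq _ q rfl hq hqs)
    (not_le.2 hlt)

/-- Two distinct vertices of the outer boundary of a component `H` of `G − T` are joined by a path
whose interior is nonempty and contained in `H`. -/
theorem exists_isPath_through {T H : Set V} (hH : H ∈ comps G T) {u v : V}
    (hu : u ∈ outerBoundary G H) (hv : v ∈ outerBoundary G H) (huv : u ≠ v) :
    ∃ p : G.Walk u v, p.IsPath ∧ 1 < p.length ∧ (∃ x ∈ H, x ∈ p.support) ∧
      ∀ x ∈ p.support, x = u ∨ x = v ∨ x ∈ H := by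
  classical
  obtain ⟨huH, a, ha, hua⟩ := hu
  obtain ⟨hvH, b, hb, hvb⟩ := hv
  obtain ⟨haT, rfl⟩ := mem_comps_of_mem hH ha
  obtain ⟨q, hq⟩ := hb
  have hqH : ∀ x ∈ q.bypass.support, x ∈ compOf G T a := fun x hx =>
    ConnAvoiding.of_mem_support hq (q.support_bypass_subset_support hx)
  have hr : (q.bypass.concat hvb.symm).IsPath :=
    q.bypass_isPath.concat (fun h => hvH (hqH v h)) _
  refine ⟨Walk.cons hua (q.bypass.concat hvb.symm), ?_, ?_, ⟨a, ha, by simp⟩, ?_⟩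
  · rw [Walk.cons_isPath_iff]
    refine ⟨hr, fun h => ?_⟩
    rw [Walk.support_concat, List.mem_append, List.mem_singleton] at h
    exact h.elim (fun h => huH (hqH u h)) huv
  · simp
  · intro x hx
    simp only [Walk.support_cons, Walk.support_concat, List.mem_cons, List.mem_append,
      List.not_mem_nil, or_false] at hx
    rcases hx with h | h | h
    exacts [Or.inl h, Or.inr (Or.inr (hqH x h)), Or.inr (Or.inl h)]

/-- A path that avoids `H` and joins two vertices of its outer boundary closes up through `H` to a
cycle. -/
theorem exists_isCycle_through {T H : Set V} (hH : H ∈ comps G T) {u v : V}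
    (hu : u ∈ outerBoundary G H) (hv : v ∈ outerBoundary G H) (huv : u ≠ v)
    (P : G.Walk v u) (hP : P.IsPath) (hPH : ∀ x ∈ P.support, x ∉ H) :
    ∃ C : G.Walk u u, C.IsCycle ∧ (∃ x ∈ H, x ∈ C.support) ∧
      ∀ x ∈ P.support, x ∈ C.support := by
  obtain ⟨p, hp, hlen, ⟨x, hxH, hx⟩, hpH⟩ := exists_isPath_through hH hu hv huv
  have hpn := hp.support_nodup
  have hPn := hP.support_nodup
  refine ⟨p.append P, hp.isCycle_append hP ?_ (Or.inl hlen), ⟨x, hxH, ?_⟩, ?_⟩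
  · intro y hy hy'
    rcases hpH y (List.mem_of_mem_tail hy) with rfl | rfl | h
    · rw [← p.cons_tail_support, List.nodup_cons] at hpn
      exact hpn.1 hy
    · rw [← P.cons_tail_support, List.nodup_cons] at hPn
      exact hPn.1 hy'
    · exact hPH y (List.mem_of_mem_tail hy') h
  · exact (Walk.mem_support_append_iff _ _).2 (Or.inl hx)
  · exact fun y hy => (Walk.mem_support_append_iff _ _).2 (Or.inr hy)

/-- `u` and `w` are joined by a path of `G` whose interior avoids `Z`. -/
def LinkedOff (G : SimpleGraph V) (Z : Set V) (u w : V) : Prop :=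
  ∃ p : G.Walk u w, p.IsPath ∧ ∀ z ∈ p.support, z ∈ Z → z = u ∨ z = w

theorem LinkedOff.symm {Z : Set V} {u w : V} (h : LinkedOff G Z u w) : LinkedOff G Z w u := by
  obtain ⟨p, hp, hpZ⟩ := h
  exact ⟨p.reverse, hp.reverse, fun z hz hzZ => (hpZ z (by simpa using hz) hzZ).symm⟩

/-- A walk from `X` to `Y` meeting `Z` only in `X ∪ Y` contains a piece linking `X` to `Y`
off `Z`. -/
theorem exists_linkedOff {Z X Y : Set V} (hXZ : X ⊆ Z) (hXY : Disjoint X Y) {u w : V}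
    (p : G.Walk u w) (hu : u ∈ X) (hw : w ∈ Y)
    (hp : ∀ z ∈ p.support, z ∈ Z → z ∈ X ∨ z ∈ Y) :
    ∃ x ∈ X, ∃ y ∈ Y, LinkedOff G Z x y := by
  classical
  have main : (∃ x ∈ X, ∃ y ∈ Y, LinkedOff G Z x y) ∨
      ∃ y ∈ Y, ∃ q : G.Walk u y, ∀ z ∈ q.support, z ∈ Z → z = y := by
    clear hu
    induction p with
    | nil => exact Or.inr ⟨_, hw, Walk.nil, by simp⟩
    | @cons u v w h p ih =>
      rcases ih hw (fun z hz => hp z (by simp [hz])) with ih | ⟨y, hy, q, hq⟩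
      · exact Or.inl ih
      by_cases huZ : u ∈ Z
      · rcases hp u (by simp) huZ with hu | hu
        · refine Or.inl ⟨u, hu, y, hy, (Walk.cons h q).bypass, Walk.bypass_isPath _, ?_⟩
          intro z hz hzZ
          have hz' := Walk.support_bypass_subset_support _ hz
          rw [Walk.support_cons, List.mem_cons] at hz'
          exact hz'.imp id fun h => hq z h hzZ
        · exact Or.inr ⟨u, hu, Walk.nil, by simp⟩
      · refine Or.inr ⟨y, hy, Walk.cons h q, fun z hz hzZ => ?_⟩
        rw [Walk.support_cons, List.mem_cons] at hz
        rcases hz with rfl | hz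
        exacts [absurd hzZ huZ, hq z hz hzZ]
  rcases main with h | ⟨y, hy, q, hq⟩
  · exact h
  · have := hq u q.start_mem_support (hXZ hu)
    subst this
    exact (Set.disjoint_left.1 hXY hu hy).elim

/-- A periodic enumeration `f` of the vertex set `Z` of a cycle of length `L`, in cyclic order. -/
structure IsCyclicEnum (G : SimpleGraph V) (Z : Set V) (L : ℕ) (f : ℕ → V) : Prop where
  adj : ∀ i, G.Adj (f i) (f (i + 1))
  periodic : ∀ i, f (i + L) = f i
  ne : ∀ i j, i < j → j < i + L → f i ≠ f j
  surj : ∀ z ∈ Z, ∀ a, ∃ e, a ≤ e ∧ e < a + L ∧ z = f e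
  mem : ∀ i, f i ∈ Z

theorem SimpleGraph.Walk.IsCycle.exists_isCyclicEnum {v : V} {C : G.Walk v v} (hC : C.IsCycle) :
    ∃ L f, IsCyclicEnum G {x | x ∈ C.support} L f := by
  have hL := hC.three_le_length
  have hend : C.getVert C.length = C.getVert 0 := by simp
  refine ⟨C.length, fun i => C.getVert (i % C.length), ⟨?_, ?_, ?_, ?_, ?_⟩⟩
  · intro i
    have hi : i % C.length < C.length := Nat.mod_lt _ (by omega)
    have hadj := C.adj_getVert_succ hi
    rcases Nat.lt_or_ge (i % C.length + 1) C.length with h | h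
    · have : (i + 1) % C.length = i % C.length + 1 := by
        rw [Nat.add_mod, Nat.mod_eq_of_lt (show 1 < C.length by omega), Nat.mod_eq_of_lt h]
      simpa only [this] using hadj
    · have h' : i % C.length + 1 = C.length := by omega
      have : (i + 1) % C.length = 0 := by
        rw [Nat.add_mod, Nat.mod_eq_of_lt (show 1 < C.length by omega), h', Nat.mod_self]
      rw [h', hend] at hadj
      simpa only [this] using hadj
  · intro i
    simp only [Nat.add_mod_right]
  · intro i j hij hji h
    have hi : i % C.length < C.length := Nat.mod_lt _ (by omega)
    have hj : j % C.length < C.length := Nat.mod_lt _ (by omega)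
    have hmod : i % C.length = j % C.length :=
      hC.getVert_injOn' (by rw [Set.mem_ofPred_eq]; omega) (by rw [Set.mem_ofPred_eq]; omega) h
    have hdvd := (Nat.modEq_iff_dvd' hij.le).1 hmod
    have := Nat.le_of_dvd (by omega) hdvd
    omega
  · intro z hz a
    obtain ⟨r, hr, rfl⟩ : ∃ r < C.length, C.getVert r = z := by
      obtain ⟨n, rfl, hn⟩ := Walk.mem_support_iff_exists_getVert.1 hz
      rcases hn.lt_or_eq with h | h
      · exact ⟨n, h, rfl⟩
      · exact ⟨0, by omega, by rw [h, hend]⟩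
    have hdm := Nat.div_add_mod a C.length
    have ha : a % C.length < C.length := Nat.mod_lt _ (by omega)
    rcases Nat.lt_or_ge r (a % C.length) with h | h
    · refine ⟨C.length * (a / C.length + 1) + r, ?_, ?_, ?_⟩
      · rw [Nat.mul_add]; omega
      · rw [Nat.mul_add]; omega
      · simp only [Nat.mul_add_mod, Nat.mod_eq_of_lt hr]
    · refine ⟨C.length * (a / C.length) + r, by omega, by omega, ?_⟩
      simp only [Nat.mul_add_mod, Nat.mod_eq_of_lt hr]
  · intro i
    exact C.getVert_mem_support _

theorem SimpleGraph.Walk.IsPath.append_of_inter {u v w : V} {p : G.Walk u v} {q : G.Walk v w}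
    (hp : p.IsPath) (hq : q.IsPath) (h : ∀ x ∈ p.support, x ∈ q.support → x = v) :
    (p.append q).IsPath := by
  have hqn := hq.support_nodup
  rw [← q.cons_tail_support, List.nodup_cons] at hqn
  rw [Walk.isPath_def, Walk.support_append, List.nodup_append']
  refine ⟨hp.support_nodup, hqn.2, fun x hx hx' => ?_⟩
  exact hqn.1 (h x hx (List.mem_of_mem_tail hx') ▸ hx')

namespace IsCyclicEnum

variable {Z H : Set V} {L : ℕ} {f : ℕ → V}

theorem exists_segment (hf : IsCyclicEnum G Z L f) {i j : ℕ} (hij : i ≤ j) (hj : j < i + L) :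
    ∃ p : G.Walk (f i) (f j), p.IsPath ∧ ∀ z, z ∈ p.support ↔ ∃ e, i ≤ e ∧ e ≤ j ∧ z = f e := by
  induction j, hij using Nat.le_induction with
  | base =>
    refine ⟨Walk.nil, Walk.IsPath.nil, fun z => ?_⟩
    rw [Walk.support_nil, List.mem_singleton]
    constructor
    · rintro rfl
      exact ⟨i, le_rfl, le_rfl, rfl⟩
    · rintro ⟨e, h1, h2, rfl⟩
      rw [le_antisymm h2 h1]
  | succ j hij ih =>
    obtain ⟨p, hp, hps⟩ := ih (by omega)
    refine ⟨p.concat (hf.adj j), hp.concat (fun h => ?_) _, fun z => ?_⟩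
    · obtain ⟨e, h1, h2, h3⟩ := (hps _).1 h
      exact hf.ne e (j + 1) (by omega) (by omega) h3.symm
    · rw [Walk.support_concat, List.mem_append, List.mem_singleton, hps]
      constructor
      · rintro (⟨e, h1, h2, rfl⟩ | rfl)
        exacts [⟨e, h1, by omega, rfl⟩, ⟨j + 1, by omega, le_rfl, rfl⟩]
      · rintro ⟨e, h1, h2, rfl⟩
        rcases h2.lt_or_eq with h | rfl
        exacts [Or.inl ⟨e, h1, by omega, rfl⟩, Or.inr rfl]

theorem connAvoiding_segment (hf : IsCyclicEnum G Z L f) {a k e : ℕ} (hk : k < L) (hae : a < e)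
    (hek : e ≤ a + k) : ConnAvoiding G (Z \ f '' Set.Ioc a (a + k)) (f (a + 1)) (f e) := by
  obtain ⟨p, -, hp⟩ := hf.exists_segment (i := a + 1) (j := e) (by omega) (by omega)
  refine ⟨p, fun x hx hx' => ?_⟩
  obtain ⟨c, h1, h2, rfl⟩ := (hp x).1 hx
  exact hx'.2 ⟨c, ⟨by omega, by omega⟩, rfl⟩

theorem compOf_subset_segment (hf : IsCyclicEnum G Z L f) {P : Set V} {a k e : ℕ} (hk : k < L)
    (hae : a < e) (hek : e ≤ a + k)
    (h : ∀ z ∈ Z, ConnAvoiding G P (f e) z → ∃ c, a < c ∧ c ≤ a + k ∧ z = f c) :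
    compOf G P (f e) ⊆ compOf G (Z \ f '' Set.Ioc a (a + k)) (f (a + 1)) := by
  rintro w ⟨p, hp⟩
  refine (hf.connAvoiding_segment hk hae hek).trans ⟨p, fun x hx hx' => ?_⟩
  obtain ⟨c, h1, h2, rfl⟩ := h x hx'.1 (ConnAvoiding.of_mem_support hp hx)
  exact hx'.2 ⟨c, ⟨h1, h2⟩, rfl⟩

/-- After every attachment `f a` of `H` there is a shortest segment which, together with what hangs
on it, has at least `h` vertices; it ends before the next attachment. -/
theorem exists_minimal_segment [Finite V] (hf : IsCyclicEnum G Z L f) {h : ℕ}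
    (hHZ : Disjoint H Z) (hBZ : outerBoundary G H ⊆ Z)
    (htwo : ∀ z ∈ Z, ∃ u ∈ outerBoundary G H, u ≠ z)
    (hlarge : ∀ (u v : V) (P : G.Walk v u), u ∈ outerBoundary G H → v ∈ outerBoundary G H →
      u ≠ v → P.IsPath → (∀ x ∈ P.support, x ∉ H) →
      ∃ z ∈ Z, z ∉ P.support ∧ h ≤ (compOf G {x | x ∈ P.support} z).ncard)
    {a : ℕ} (ha : f a ∈ outerBoundary G H) :
    ∃ m, 1 ≤ m ∧ m < L ∧ h ≤ (compOf G (Z \ f '' Set.Ioc a (a + m)) (f (a + 1))).ncard ∧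
      (∀ e, a < e → e ≤ a + m → f e ∉ outerBoundary G H) ∧
      ∀ k, 1 ≤ k → k < m →
        (compOf G (Z \ f '' Set.Ioc a (a + k)) (f (a + 1))).ncard < h := by
  classical
  have hex : ∃ g, 1 ≤ g ∧ f (a + g) ∈ outerBoundary G H ∧ g < L := by
    obtain ⟨u, hu, hua⟩ := htwo _ (hBZ ha)
    obtain ⟨e, h1, h2, rfl⟩ := hf.surj u (hBZ hu) a
    have : e ≠ a := fun h => hua (by rw [h])
    exact ⟨e - a, by omega, by rwa [Nat.add_sub_cancel' h1], by omega⟩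
  obtain ⟨hg1, hgB, hgL⟩ := Nat.find_spec hex
  have hgmin : ∀ e, a < e → e < a + Nat.find hex → f e ∉ outerBoundary G H := by
    intro e h1 h2 h3
    refine Nat.find_min hex (m := e - a) (by omega) ⟨by omega, ?_, by omega⟩
    rwa [Nat.add_sub_cancel' h1.le]
  generalize Nat.find hex = g at *
  have hm : ∃ m, 1 ≤ m ∧ m < g ∧
      h ≤ (compOf G (Z \ f '' Set.Ioc a (a + m)) (f (a + 1))).ncard := by
    obtain ⟨P, hP, hPs⟩ := hf.exists_segment (i := a + g) (j := a + L) (by omega) (by omega)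
    have hPe : ∀ z ∈ Z, z ∉ P.support → ∃ c, a < c ∧ c ≤ a + (g - 1) ∧ z = f c := by
      intro z hz hzP
      obtain ⟨e, h1, h2, rfl⟩ := hf.surj z hz (a + 1)
      refine ⟨e, by omega, ?_, rfl⟩
      by_contra hlt
      exact hzP ((hPs _).2 ⟨e, by omega, by omega, rfl⟩)
    obtain ⟨z, hz, hzP, hzl⟩ := hlarge (f (a + L)) (f (a + g)) P (by rwa [hf.periodic]) hgB
      (fun h => hf.ne (a + g) (a + L) (by omega) (by omega) h.symm) hP (by
        intro x hx hxH
        obtain ⟨e, -, -, rfl⟩ := (hPs x).1 hx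
        exact Set.disjoint_left.1 hHZ hxH (hf.mem e))
    obtain ⟨e, h1, h2, rfl⟩ := hPe z hz hzP
    refine ⟨g - 1, by omega, by omega, hzl.trans (Set.ncard_le_ncard ?_ (Set.toFinite _))⟩
    exact hf.compOf_subset_segment (by omega) h1 h2 fun z hz hez => hPe z hz hez.right_notMem
  obtain ⟨hm1, hmg, hml⟩ := Nat.find_spec hm
  refine ⟨Nat.find hm, hm1, by omega, hml, fun e h1 h2 => hgmin e h1 (by omega), ?_⟩
  intro k hk1 hk
  by_contra! hkl
  exact Nat.find_min hm hk ⟨hk1, by omega, hkl⟩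

/-- No path off the cycle links the minimal segments after two different attachments of `H`. -/
theorem not_linkedOff_segments [Finite V] (hf : IsCyclicEnum G Z L f) {h : ℕ}
    (hHZ : Disjoint H Z) (hBZ : outerBoundary G H ⊆ Z)
    (hlarge : ∀ (u v : V) (P : G.Walk v u), u ∈ outerBoundary G H → v ∈ outerBoundary G H →
      u ≠ v → P.IsPath → (∀ x ∈ P.support, x ∉ H) →
      ∃ z ∈ Z, z ∉ P.support ∧ h ≤ (compOf G {x | x ∈ P.support} z).ncard)
    {a b m n : ℕ} (hab : a < b) (hba : b < a + L)
    (ha : f a ∈ outerBoundary G H) (hb : f b ∈ outerBoundary G H)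
    (hm : ∀ e, a < e → e ≤ a + m → f e ∉ outerBoundary G H)
    (hn : ∀ e, b < e → e ≤ b + n → f e ∉ outerBoundary G H)
    (hmmin : ∀ k, 1 ≤ k → k < m →
      (compOf G (Z \ f '' Set.Ioc a (a + k)) (f (a + 1))).ncard < h)
    (hnmin : ∀ k, 1 ≤ k → k < n →
      (compOf G (Z \ f '' Set.Ioc b (b + k)) (f (b + 1))).ncard < h)
    {x y : ℕ} (hax : a < x) (hxm : x ≤ a + m) (hby : b < y) (hyn : y ≤ b + n) :
    ¬ LinkedOff G Z (f x) (f y) := by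
  have haL : f (a + L) ∈ outerBoundary G H := by rwa [hf.periodic]
  have hmb : a + m < b := by
    by_contra hlt
    exact hm b hab (by omega) hb
  have hna : b + n < a + L := by
    by_contra hlt
    exact hn (a + L) hba (by omega) haL
  induction hd : x + y using Nat.strong_induction_on generalizing x y with
  | _ d ih =>
    rintro ⟨Q, hQ, hQZ⟩
    obtain ⟨R, hR, hRs⟩ := hf.exists_segment (i := x) (j := b) (by omega) (by omega)
    obtain ⟨R', hR', hRs'⟩ := hf.exists_segment (i := y) (j := a + L) (by omega) (by omega)
    have hRQ : (R.reverse.append Q).IsPath := by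
      refine hR.reverse.append_of_inter hQ fun w hw hwQ => ?_
      rw [Walk.support_reverse, List.mem_reverse, hRs] at hw
      obtain ⟨e, h1, h2, rfl⟩ := hw
      rcases hQZ _ hwQ (hf.mem e) with h | h
      · exact h
      · exact absurd h (hf.ne e y (by omega) (by omega))
    obtain ⟨P, hP, hPs⟩ : ∃ P : G.Walk (f b) (f (a + L)), P.IsPath ∧
        ∀ z, z ∈ P.support ↔ z ∈ R.support ∨ z ∈ Q.support ∨ z ∈ R'.support := by
      refine ⟨(R.reverse.append Q).append R', hRQ.append_of_inter hR' fun w hw hwR => ?_, ?_⟩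
      · rw [Walk.mem_support_append_iff, Walk.support_reverse, List.mem_reverse] at hw
        obtain ⟨e, h1, h2, rfl⟩ := (hRs' _).1 hwR
        rcases hw with hw | hw
        · obtain ⟨c, h3, h4, h5⟩ := (hRs _).1 hw
          exact absurd h5.symm (hf.ne c e (by omega) (by omega))
        · rcases hQZ _ hw (hf.mem e) with h | h
          · exact absurd h.symm (hf.ne x e (by omega) (by omega))
          · exact h
      · intro z
        rw [Walk.mem_support_append_iff, Walk.mem_support_append_iff, Walk.support_reverse,
          List.mem_reverse, or_assoc]
    have hPe : ∀ z ∈ Z, z ∉ P.support →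
        (∃ e, a < e ∧ e < x ∧ z = f e) ∨ ∃ e, b < e ∧ e < y ∧ z = f e := by
      intro z hz hzP
      rw [hPs, not_or, not_or] at hzP
      obtain ⟨e, h1, h2, rfl⟩ := hf.surj z hz (a + 1)
      rcases Nat.lt_or_ge e x with h | h
      · exact Or.inl ⟨e, h1, h, rfl⟩
      refine Or.inr ⟨e, ?_, ?_, rfl⟩
      · by_contra hlt
        exact hzP.1 ((hRs _).2 ⟨e, h, by omega, rfl⟩)
      · by_contra hlt
        exact hzP.2.2 ((hRs' _).2 ⟨e, by omega, by omega, rfl⟩)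
    have hsep : ∀ e c, a < e → e < x → b < c → c < y →
        ¬ ConnAvoiding G {z | z ∈ P.support} (f e) (f c) := by
      rintro e c h1 h2 h3 h4 ⟨p, hp⟩
      obtain ⟨_, ⟨x', hx', rfl⟩, _, ⟨y', hy', rfl⟩, hl⟩ := exists_linkedOff (Z := Z)
        (X := f '' Set.Ioo a x) (Y := f '' Set.Ioo b y) (by
          rintro _ ⟨i, -, rfl⟩
          exact hf.mem i) (by
          rw [Set.disjoint_left]
          rintro _ ⟨i, ⟨hi1, hi2⟩, rfl⟩ ⟨j, ⟨hj1, hj2⟩, hij⟩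
          exact hf.ne i j (by omega) (by omega) hij.symm) p ⟨e, ⟨h1, h2⟩, rfl⟩
        ⟨c, ⟨h3, h4⟩, rfl⟩ (by
          intro z hz hzZ
          rcases hPe z hzZ (hp z hz) with ⟨i, h5, h6, rfl⟩ | ⟨i, h5, h6, rfl⟩
          exacts [Or.inl ⟨i, ⟨h5, h6⟩, rfl⟩, Or.inr ⟨i, ⟨h5, h6⟩, rfl⟩])
      have hxx := hx'.2
      have hyy := hy'.2
      exact ih (x' + y') (by omega) hx'.1 (by omega) hy'.1 (by omega) rfl hl
    have hPH : ∀ z ∈ P.support, z ∉ H := by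
      intro z hz hzH
      rcases (hPs z).1 hz with h | h | h
      · obtain ⟨e, -, -, rfl⟩ := (hRs z).1 h
        exact Set.disjoint_left.1 hHZ hzH (hf.mem e)
      · classical
        obtain ⟨w, hw, hwB⟩ := exists_mem_support_outerBoundary (Q.dropUntil z h) hzH
          (fun hy => Set.disjoint_left.1 hHZ hy (hf.mem y))
        rcases hQZ w (Q.support_dropUntil_subset_support h hw) (hBZ hwB) with rfl | rfl
        exacts [hm x hax hxm hwB, hn y hby hyn hwB]
      · obtain ⟨e, -, -, rfl⟩ := (hRs' z).1 h
        exact Set.disjoint_left.1 hHZ hzH (hf.mem e)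
    obtain ⟨z, hz, hzP, hzl⟩ := hlarge (f (a + L)) (f b) P haL hb
      (fun h => hf.ne b (a + L) (by omega) (by omega) h.symm) hP hPH
    rcases hPe z hz hzP with ⟨e, h1, h2, rfl⟩ | ⟨e, h1, h2, rfl⟩
    · refine absurd (hmmin (x - a - 1) (by omega) (by omega)) (not_lt.2 (hzl.trans ?_))
      refine Set.ncard_le_ncard (hf.compOf_subset_segment (by omega) h1 (by omega) ?_)
        (Set.toFinite _)
      intro z hz hez
      rcases hPe z hz hez.right_notMem with ⟨c, h3, h4, rfl⟩ | ⟨c, h3, h4, rfl⟩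
      exacts [⟨c, h3, by omega, rfl⟩, (hsep e c h1 h2 h3 h4 hez).elim]
    · refine absurd (hnmin (y - b - 1) (by omega) (by omega)) (not_lt.2 (hzl.trans ?_))
      refine Set.ncard_le_ncard (hf.compOf_subset_segment (by omega) h1 (by omega) ?_)
        (Set.toFinite _)
      intro z hz hez
      rcases hPe z hz hez.right_notMem with ⟨c, h3, h4, rfl⟩ | ⟨c, h3, h4, rfl⟩
      exacts [(hsep c e h3 h4 h1 h2 hez.symm).elim, ⟨c, h3, by omega, rfl⟩]

/-- Deleting the cycle except for the minimal segments separates the segments after the different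
attachments of `H` from each other, and leaves each of them in a component of at least `h`
vertices. -/
theorem exists_separator [Finite V] (hf : IsCyclicEnum G Z L f) {h : ℕ}
    (hHZ : Disjoint H Z) (hBZ : outerBoundary G H ⊆ Z)
    (htwo : ∀ z ∈ Z, ∃ u ∈ outerBoundary G H, u ≠ z)
    (hlarge : ∀ (u v : V) (P : G.Walk v u), u ∈ outerBoundary G H → v ∈ outerBoundary G H →
      u ≠ v → P.IsPath → (∀ x ∈ P.support, x ∉ H) →
      ∃ z ∈ Z, z ∉ P.support ∧ h ≤ (compOf G {x | x ∈ P.support} z).ncard) :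
    ∃ S ⊆ Z, outerBoundary G H ⊆ S ∧
      (∀ a < L, f a ∈ outerBoundary G H →
        f (a + 1) ∉ S ∧ h ≤ (compOf G S (f (a + 1))).ncard) ∧
      ∀ a < L, ∀ b < L, f a ∈ outerBoundary G H → f b ∈ outerBoundary G H → a ≠ b →
        ¬ ConnAvoiding G S (f (a + 1)) (f (b + 1)) := by
  have hpre : ∀ a, ∃ m, f a ∈ outerBoundary G H → 1 ≤ m ∧ m < L ∧
      h ≤ (compOf G (Z \ f '' Set.Ioc a (a + m)) (f (a + 1))).ncard ∧
      (∀ e, a < e → e ≤ a + m → f e ∉ outerBoundary G H) ∧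
      ∀ k, 1 ≤ k → k < m →
        (compOf G (Z \ f '' Set.Ioc a (a + k)) (f (a + 1))).ncard < h := by
    intro a
    by_cases ha : f a ∈ outerBoundary G H
    · obtain ⟨m, hm⟩ := hf.exists_minimal_segment hHZ hBZ htwo hlarge ha
      exact ⟨m, fun _ => hm⟩
    · exact ⟨0, fun h => absurd h ha⟩
  choose m hm using hpre
  have hdisj : ∀ a b, f a ∈ outerBoundary G H → f b ∈ outerBoundary G H → a < b → b < L →
      ∀ x y, a < x → x ≤ a + m a → b < y → y ≤ b + m b → f x ≠ f y := by
    intro a b ha hb hab hbL x y hax hxm hby hyn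
    have h1 : a + m a < b := by
      by_contra hlt
      exact (hm a ha).2.2.2.1 b hab (by omega) hb
    have h2 : b + m b < a + L := by
      by_contra hlt
      exact (hm b hb).2.2.2.1 (a + L) (by omega) (by omega) (by rwa [hf.periodic])
    exact hf.ne x y (by omega) (by omega)
  have hlink : ∀ a b, f a ∈ outerBoundary G H → f b ∈ outerBoundary G H → a < b → b < L →
      ∀ x y, a < x → x ≤ a + m a → b < y → y ≤ b + m b → ¬ LinkedOff G Z (f x) (f y) := by
    intro a b ha hb hab hbL x y hax hxm hby hyn
    exact hf.not_linkedOff_segments hHZ hBZ hlarge hab (by omega) ha hb (hm a ha).2.2.2.1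
      (hm b hb).2.2.2.1 (hm a ha).2.2.2.2 (hm b hb).2.2.2.2 hax hxm hby hyn
  refine ⟨{z | z ∈ Z ∧ ∀ a < L, f a ∈ outerBoundary G H → z ∉ f '' Set.Ioc a (a + m a)},
    fun z hz => hz.1, ?_, ?_, ?_⟩
  · intro z hz
    refine ⟨hBZ hz, ?_⟩
    rintro a - ha ⟨e, ⟨h1, h2⟩, rfl⟩
    exact (hm a ha).2.2.2.1 e h1 h2 hz
  · intro a haL ha
    obtain ⟨h1, h2, h3, -, -⟩ := hm a ha
    refine ⟨fun hS => hS.2 a haL ha ⟨a + 1, ⟨by omega, by omega⟩, rfl⟩,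
      h3.trans (Set.ncard_le_ncard ?_ (Set.toFinite _))⟩
    intro w hw
    refine ConnAvoiding.mono ?_ hw
    exact fun z hz => ⟨hz.1, hz.2 a haL ha⟩
  · rintro a haL b hbL ha hb hab ⟨p, hp⟩
    obtain ⟨_, ⟨x, ⟨hx1, hx2⟩, rfl⟩, _, ⟨c, hcL, hc, hca, y, ⟨hy1, hy2⟩, rfl⟩, hl⟩ :=
      exists_linkedOff (Z := Z) (X := f '' Set.Ioc a (a + m a))
        (Y := {z | ∃ c < L, f c ∈ outerBoundary G H ∧ c ≠ a ∧ z ∈ f '' Set.Ioc c (c + m c)})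
        (by
          rintro _ ⟨i, -, rfl⟩
          exact hf.mem i)
        (by
          rw [Set.disjoint_left]
          rintro _ ⟨i, ⟨hi1, hi2⟩, rfl⟩ ⟨c, hcL, hc, hca, j, ⟨hj1, hj2⟩, hij⟩
          rcases Nat.lt_or_gt_of_ne hca with h | h
          · exact hdisj c a hc ha h haL j i hj1 hj2 hi1 hi2 hij
          · exact hdisj a c ha hc h hcL i j hi1 hi2 hj1 hj2 hij.symm)
        p ⟨a + 1, ⟨by omega, by have := (hm a ha).1; omega⟩, rfl⟩
        ⟨b, hbL, hb, hab.symm, b + 1, ⟨by omega, by have := (hm b hb).1; omega⟩, rfl⟩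
        (by
          intro z hz hzZ
          have hzS := hp z hz
          by_contra! hcon
          refine hzS ⟨hzZ, fun c hcL hc hzc => ?_⟩
          by_cases hca : c = a
          · exact hcon.1 (hca ▸ hzc)
          · exact hcon.2 ⟨c, hcL, hc, hca, hzc⟩)
    rcases Nat.lt_or_gt_of_ne hca with h | h
    · exact hlink c a hc ha h haL y x hy1 hy2 hx1 hx2 hl.symm
    · exact hlink a c ha hc h hcL x y hx1 hx2 hy1 hy2 hl

end IsCyclicEnum

/-- In a `t`-tough graph, a separator leaving at least `k ≥ 2` components of at least `h` vertices
forces at least `(t + h) k` vertices. -/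
theorem Tough.le_card_of_separated [Fintype V] {t : ℝ} (ht : 0 ≤ t) (htough : Tough t G)
    {ι : Type*} [Fintype ι] (hι : 2 ≤ Fintype.card ι) (S : Set V) (pt : ι → V) (h : ℕ)
    (hpt : ∀ i, pt i ∉ S) (hlarge : ∀ i, h ≤ (compOf G S (pt i)).ncard)
    (hsep : ∀ i j, i ≠ j → ¬ ConnAvoiding G S (pt i) (pt j)) :
    (t + h) * Fintype.card ι ≤ Fintype.card V := by
  classical
  have hnum : Fintype.card ι ≤ numComp G S := by
    rw [← Nat.card_eq_fintype_card]
    refine Nat.card_le_card_of_injective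
      (fun i => (G.induce Sᶜ).connectedComponentMk ⟨pt i, hpt i⟩) fun i j hij => ?_
    by_contra hne
    exact hsep i j hne
      ((connAvoiding_iff_reachable (hpt i) (hpt j)).2 (ConnectedComponent.eq.1 hij))
  have hS := htough S.toFinset
  rw [Set.coe_toFinset] at hS
  have hS' : t * Fintype.card ι ≤ S.toFinset.card :=
    (mul_le_mul_of_nonneg_left (by exact_mod_cast hnum) ht).trans (hS (hι.trans hnum))
  have hsum : S.toFinset.card + Fintype.card ι * h ≤ Fintype.card V := by
    have hdis : ∀ i j, i ≠ j →
        Disjoint (compOf G S (pt i)).toFinset (compOf G S (pt j)).toFinset := by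
      intro i j hij
      rw [Set.disjoint_toFinset, Set.disjoint_left]
      exact fun x hx hx' => hsep i j hij (ConnAvoiding.trans hx (ConnAvoiding.symm hx'))
    have hcard : Fintype.card ι * h ≤
        (Finset.univ.biUnion fun i => (compOf G S (pt i)).toFinset).card := by
      rw [Finset.card_biUnion fun i _ j _ hij => hdis i j hij, ← smul_eq_mul]
      refine Finset.card_nsmul_le_sum _ _ _ fun i _ => ?_
      rw [← Set.ncard_eq_toFinset_card']
      exact hlarge i
    have hdisS : Disjoint S.toFinset
        (Finset.univ.biUnion fun i => (compOf G S (pt i)).toFinset) := by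
      rw [Finset.disjoint_left]
      intro x hx hx'
      obtain ⟨i, -, hi⟩ := Finset.mem_biUnion.1 hx'
      rw [Set.mem_toFinset] at hi
      exact ConnAvoiding.right_notMem hi (Set.mem_toFinset.1 hx)
    have := Finset.card_le_univ (S.toFinset ∪
      Finset.univ.biUnion fun i => (compOf G S (pt i)).toFinset)
    rw [Finset.card_union_of_disjoint hdisS] at this
    omega
  have hsum' : (S.toFinset.card : ℝ) + Fintype.card ι * h ≤ Fintype.card V := by
    exact_mod_cast hsum
  linarith [add_mul t (h : ℝ) (Fintype.card ι), mul_comm (h : ℝ) (Fintype.card ι)]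

end ToughCycles


/-- Let `G` be a `2`-connected `t`-tough graph of order `n` having a `D_{s+1}`-cycle but
no `D_s`-cycle, and let `C` be a `D_{s+1}`-cycle chosen so that the tuple
`(c_s(G−V(C)), …, c₁(G−V(C)))` is lexicographically minimal. Then
`n ≥ (t + |V(H)|)(d_G(H) + 1)` for every component `H` of `G − V(C)`. -/
theorem stmt4 {V : Type*} [Fintype V] (t : ℝ) (ht : 0 < t) (G : SimpleGraph V)
    (h2conn : 3 ≤ Fintype.card V ∧ ∀ v : V, (G.induce {v}ᶜ).Connected)
    (htough : Tough t G) (s : ℕ) (hs : 1 ≤ s)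
    (hnoDs : ∀ (w : V) (C' : G.Walk w w), ¬ IsDCycle G C' s)
    (v : V) (C : G.Walk v v) (hC : IsDCycle G C (s + 1))
    (hlexmin : ∀ (w : V) (C' : G.Walk w w), IsDCycle G C' (s + 1) →
      ∀ p : ℕ, 1 ≤ p → p ≤ s →
        (∀ q : ℕ, p < q → q ≤ s →
          numCompGe G {x : V | x ∈ C'.support} q = numCompGe G {x : V | x ∈ C.support} q) →
        numCompGe G {x : V | x ∈ C.support} p ≤ numCompGe G {x : V | x ∈ C'.support} p)
    (H : (G.induce {x : V | x ∈ C.support}ᶜ).ConnectedComponent) :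
    (t + (Nat.card H.supp : ℝ)) *
        ((Nat.card {x : V | x ∉ Subtype.val '' H.supp ∧
            ∃ y ∈ Subtype.val '' H.supp, G.Adj x y} : ℕ) + 1 : ℝ) ≤
      (Fintype.card V : ℝ) := by


  classical
  have hHc := coe_image_supp_mem_comps H
  rw [card_supp_eq_ncard_image]
  obtain ⟨h₀, hh₀⟩ : (Subtype.val '' H.supp).Nonempty := H.nonempty_supp.image _
  change (t + _) * ((Nat.card (outerBoundary G (Subtype.val '' H.supp)) : ℝ) + 1) ≤ _
  generalize Subtype.val '' H.supp = K at *
  have hBZ := outerBoundary_subset_of_mem_comps hHc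
  have hKZ : Disjoint K {x | x ∈ C.support} :=
    Set.disjoint_left.2 fun x hx => (mem_comps_of_mem hHc hx).1
  obtain ⟨L, f, hf⟩ := hC.1.exists_isCyclicEnum
  have hL : 0 < L := by
    obtain ⟨e, h1, h2, -⟩ := hf.surj v C.start_mem_support 0
    omega
  have htwo : ∀ z ∈ {x | x ∈ C.support}, ∃ u ∈ outerBoundary G K, u ≠ z := by
    intro z hz
    obtain ⟨e, -, -, rfl⟩ := hf.surj z hz 0
    have h0 : h₀ ∉ ({f e} : Set V) := fun h =>
      Set.disjoint_left.1 hKZ hh₀ (Set.mem_singleton_iff.1 h ▸ hf.mem e)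
    have h1 : f (e + 1) ∉ ({f e} : Set V) := fun h =>
      (hf.adj e).ne (Set.mem_singleton_iff.1 h).symm
    obtain ⟨p, hp⟩ := (connAvoiding_iff_reachable h0 h1).2 ((h2conn.2 (f e)).preconnected _ _)
    obtain ⟨u, hu, huB⟩ := exists_mem_support_outerBoundary p hh₀
      (fun h => Set.disjoint_left.1 hKZ h (hf.mem _))
    exact ⟨u, huB, hp u hu⟩
  have hlarge : ∀ (u v : V) (P : G.Walk v u), u ∈ outerBoundary G K → v ∈ outerBoundary G K →
      u ≠ v → P.IsPath → (∀ x ∈ P.support, x ∉ K) →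
      ∃ z ∈ {x | x ∈ C.support}, z ∉ P.support ∧
        K.ncard ≤ (compOf G {x | x ∈ P.support} z).ncard := by
    intro u v P hu hv huv hP hPK
    obtain ⟨C', hC', hKC', hPC'⟩ := exists_isCycle_through hHc hu hv huv P hP hPK
    obtain ⟨z, hz, hzC', hzl⟩ := exists_large_component_of_lexmin C hC hlexmin hHc C' hC' hKC'
    exact ⟨z, hz, fun h => hzC' (hPC' z h), hzl.trans
      (Set.ncard_le_ncard (fun w hw => ConnAvoiding.mono (fun x hx => hPC' x hx) hw)
        (Set.toFinite _))⟩
  obtain ⟨S, hSZ, hBS, hS, hsep⟩ := hf.exists_separator hKZ hBZ htwo hlarge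
  have hcard : Nat.card (outerBoundary G K) =
      Fintype.card {a : Fin L // f a ∈ outerBoundary G K} := by
    rw [← Nat.card_eq_fintype_card]
    refine (Nat.card_congr (Equiv.ofBijective
      (fun a : {a : Fin L // f a ∈ outerBoundary G K} =>
        (⟨f a.1, a.2⟩ : outerBoundary G K)) ⟨?_, ?_⟩)).symm
    · rintro ⟨⟨a, ha⟩, ha'⟩ ⟨⟨b, hb⟩, hb'⟩ hab
      have hab' : f a = f b := congrArg Subtype.val hab
      rcases lt_trichotomy a b with h | rfl | h
      · exact absurd hab' (hf.ne a b h (by omega))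
      · rfl
      · exact absurd hab'.symm (hf.ne b a h (by omega))
    · rintro ⟨u, hu⟩
      obtain ⟨e, -, h2, rfl⟩ := hf.surj u (hBZ hu) 0
      exact ⟨⟨⟨e, by omega⟩, hu⟩, rfl⟩
  have hpos : 0 < Nat.card (outerBoundary G K) := by
    obtain ⟨u, hu, -⟩ := htwo v C.start_mem_support
    exact Nat.card_pos_iff.2 ⟨⟨u, hu⟩, inferInstance⟩
  have hnot : ∀ i, ¬ ConnAvoiding G S h₀ (f i) := fun i hi =>
    Set.disjoint_left.1 hKZ (hi.mem_of_outerBoundary_subset hh₀ hBS) (hf.mem i)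
  have hfin := htough.le_card_of_separated ht.le
    (ι := Option {a : Fin L // f a ∈ outerBoundary G K})
    (by rw [Fintype.card_option, ← hcard]; omega) S
    (fun i => i.elim h₀ fun a => f (a.1 + 1)) K.ncard
    (by
      rintro (_ | ⟨a, ha⟩)
      · exact fun h => Set.disjoint_left.1 hKZ hh₀ (hSZ h)
      · exact (hS a a.2 ha).1)
    (by
      rintro (_ | ⟨a, ha⟩)
      · refine Set.ncard_le_ncard (fun x hx => ?_) (Set.toFinite _)
        rw [(mem_comps_of_mem hHc hh₀).2] at hx
        exact ConnAvoiding.mono hSZ hx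
      · exact (hS a a.2 ha).2)
    (by
      rintro (_ | ⟨a, ha⟩) (_ | ⟨b, hb⟩) hab
      · exact absurd rfl hab
      · exact hnot _
      · exact fun h => hnot _ h.symm
      · refine hsep a a.2 b b.2 ha hb fun h => hab ?_
        obtain rfl := Fin.ext h
        rfl)
  rw [Fintype.card_option, ← hcard] at hfin
  push_cast at hfin
  exact hfin
end

section
/- Let t > 0, let G be a 2-connected t-tough graph of order n, and let λ ≥ 1 be an integer such that G has a D_{λ+1}-cycle but no D_λ-cycle. Let C be a cycle of G such that every component of G − V(C) either has at most λ−1 vertices or is a path with at least λ vertices. Then G − V(C) has a component H that is a path with at least λ vertices containing a vertex x with deg_G(x,C) ≤ n/(t+1) − λ. -/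
open SimpleGraph

/-- A connected component `c` of `G − V(C)` "is a path": the subgraph induced on `c` is
isomorphic to the path graph on `|c|` vertices. -/
def IsPathComponent {V : Type*} (G : SimpleGraph V) (S : Set V)
    (c : (G.induce Sᶜ).ConnectedComponent) : Prop :=
  Nonempty (((G.induce Sᶜ).induce c.supp) ≃g pathGraph (Nat.card c.supp))

namespace SimpleGraph

variable {V : Type*} (G : SimpleGraph V)

/-- The vertices reachable from `x` by a walk staying inside `U`; empty if `x ∉ U`. -/
def compIn (U : Set V) (x : V) : Set V :=
  {y | ∃ p : G.Walk x y, ∀ z ∈ p.support, z ∈ U}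

/-- The set `A` together with the components of `U` having a neighbour in `A`. -/
def attach (U A : Set V) : Set V :=
  {y | y ∈ A ∨ ∃ a ∈ A, ∃ q, G.Adj a q ∧ y ∈ G.compIn U q}

/-- `a` and `b` are adjacent, or joined by a path whose interior is in `U`. -/
def LinkedIn (U : Set V) (a b : V) : Prop :=
  G.Adj a b ∨ ∃ p, G.Adj a p ∧ ∃ q ∈ G.compIn U p, G.Adj q b

/-- The list `l` enumerates the vertices of a cycle of `G` in cyclic order. -/
def IsCycleList (l : List V) : Prop :=
  Cycle.Chain G.Adj (l : Cycle V) ∧ l.Nodup ∧ 3 ≤ l.length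

variable {G} {U A B : Set V} {x y z a b : V}

lemma mem_of_mem_compIn (h : y ∈ G.compIn U x) : y ∈ U := by
  obtain ⟨p, hp⟩ := h
  exact hp _ p.end_mem_support

lemma mem_compIn_self (h : x ∈ U) : x ∈ G.compIn U x :=
  ⟨Walk.nil, by simpa using h⟩

lemma mem_compIn_symm (h : y ∈ G.compIn U x) : x ∈ G.compIn U y := by
  obtain ⟨p, hp⟩ := h
  exact ⟨p.reverse, by simpa using hp⟩

lemma mem_compIn_trans (h : y ∈ G.compIn U x) (h' : z ∈ G.compIn U y) : z ∈ G.compIn U x := by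
  obtain ⟨p, hp⟩ := h
  obtain ⟨q, hq⟩ := h'
  refine ⟨p.append q, fun w hw => ?_⟩
  rw [Walk.mem_support_append_iff] at hw
  exact hw.elim (hp w) (hq w)

lemma mem_compIn_of_adj (h : y ∈ G.compIn U x) (hyz : G.Adj y z) (hz : z ∈ U) :
    z ∈ G.compIn U x :=
  mem_compIn_trans h ⟨hyz.toWalk, by
    intro w hw
    have hy := mem_of_mem_compIn h
    simp at hw
    grind⟩

lemma compIn_eq (h : y ∈ G.compIn U x) : G.compIn U y = G.compIn U x :=
  Set.Subset.antisymm (fun _ hw => mem_compIn_trans h hw)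
    (fun _ hw => mem_compIn_trans (mem_compIn_symm h) hw)

lemma compIn_subset_of_closed {D : Set V} (hx : x ∈ D)
    (hD : ∀ y ∈ D, ∀ z ∈ U, G.Adj y z → z ∈ D) : G.compIn U x ⊆ D := by
  rintro y ⟨p, hp⟩
  induction p with
  | nil => exact hx
  | cons h p ih =>
    simp only [Walk.support_cons, List.mem_cons] at hp
    exact ih (hD _ hx _ (hp _ (Or.inr p.start_mem_support)) h) (fun z hz => hp z (Or.inr hz))

lemma exists_detour {u w : V} (hau : G.Adj a u) (hw : w ∈ G.compIn U u) (hwb : G.Adj w b) :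
    ∃ P : List V, P ≠ [] ∧ P.Nodup ∧ (∀ z ∈ P, z ∈ G.compIn U u) ∧
      List.IsChain G.Adj (a :: (P ++ [b])) := by
  classical
  obtain ⟨p, hp⟩ := hw
  have hp' : ∀ z ∈ p.bypass.support, z ∈ U := fun z hz =>
    hp z (p.support_bypass_subset_support hz)
  refine ⟨p.bypass.support, by simp, p.bypass_isPath.support_nodup, fun z hz => ?_, ?_⟩
  · exact ⟨p.bypass.takeUntil z hz, fun t ht => hp' t (Walk.support_takeUntil_subset_support _ _ ht)⟩
  · have := (Walk.cons hau (p.bypass.append hwb.toWalk)).isChain_adj_support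
    simpa [Walk.support_append] using this

lemma mem_attach_of_adj (h : y ∈ G.attach U A) (hyz : G.Adj y z) (hz : z ∈ U) :
    z ∈ G.attach U A := by
  rcases h with h | ⟨a, ha, q, haq, hy⟩
  · exact Or.inr ⟨y, h, z, hyz, mem_compIn_self hz⟩
  · exact Or.inr ⟨a, ha, q, haq, mem_compIn_of_adj hy hyz hz⟩

lemma exists_linkedIn_of_mem_attach (h : y ∈ G.attach U A) (hyz : G.Adj y z) :
    ∃ a ∈ A, G.LinkedIn U a z := by
  rcases h with h | ⟨a, ha, q, haq, hy⟩
  · exact ⟨y, h, Or.inl hyz⟩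
  · exact ⟨a, ha, Or.inr ⟨q, haq, y, hy, hyz⟩⟩

lemma attach_empty : G.attach U ∅ = ∅ := by
  ext y; simp [attach]

lemma LinkedIn.symm (h : G.LinkedIn U a b) : G.LinkedIn U b a := by
  rcases h with h | ⟨p, hap, q, hq, hqb⟩
  · exact Or.inl h.symm
  · exact Or.inr ⟨q, hqb.symm, p, mem_compIn_symm hq, hap.symm⟩

lemma disjoint_attach (hAB : Disjoint A B) (hA : Disjoint A U) (hB : Disjoint B U)
    (hl : ∀ a ∈ A, ∀ b ∈ B, ¬ G.LinkedIn U a b) :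
    Disjoint (G.attach U A) (G.attach U B) := by
  rw [Set.disjoint_left] at *
  rintro y (h | ⟨a, ha, q, haq, hy⟩) (h' | ⟨b, hb, r, hbr, hy'⟩)
  · exact hAB h h'
  · exact hA h (mem_of_mem_compIn hy')
  · exact hB h' (mem_of_mem_compIn hy)
  · exact hl a ha b hb (Or.inr ⟨q, haq, r, mem_compIn_trans hy (mem_compIn_symm hy'), hbr.symm⟩)

lemma compIn_subset_attach {U' X Y : Set V} (hU' : U' ⊆ U ∪ X ∪ Y)
    (hl : ∀ a ∈ X, ∀ b ∈ Y, ¬ G.LinkedIn U a b) (hx : x ∈ X) :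
    G.compIn U' x ⊆ G.attach U X := by
  refine compIn_subset_of_closed (Or.inl hx) fun y hy z hz hyz => ?_
  rcases hU' hz with (h | h) | h
  · exact mem_attach_of_adj hy hyz h
  · exact Or.inl h
  · obtain ⟨a, ha, hl'⟩ := exists_linkedIn_of_mem_attach hy hyz
    exact absurd hl' (hl a ha z h)

/-- Removing from `U` and adding two unlinked sets with small attachments creates only components
that are small or were already contained in `U`. -/
lemma ncard_compIn_lt_or_subset [Finite V] {U' X Y : Set V} {m : ℕ} (hU' : U' ⊆ U ∪ X ∪ Y)
    (hl : ∀ a ∈ X, ∀ b ∈ Y, ¬ G.LinkedIn U a b)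
    (hX : (G.attach U X).ncard < m) (hY : (G.attach U Y).ncard < m) (z : V) :
    (G.compIn U' z).ncard < m ∨ G.compIn U' z ⊆ U := by
  by_cases h : ∃ x ∈ G.compIn U' z, x ∈ X ∪ Y
  · left
    obtain ⟨x, hx, hxX | hxY⟩ := h
    · rw [← compIn_eq hx]
      exact (Set.ncard_le_ncard (compIn_subset_attach hU' hl hxX)).trans_lt hX
    · rw [← compIn_eq hx]
      refine (Set.ncard_le_ncard (compIn_subset_attach (X := Y) (Y := X) ?_ ?_ hxY)).trans_lt hY
      · intro w hw
        have := hU' hw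
        simp only [Set.mem_union] at *
        tauto
      · exact fun a ha b hb h => hl b hb a ha h.symm
  · right
    intro w hw
    have h1 := hU' (mem_of_mem_compIn hw)
    push Not at h
    have h2 := h w hw
    simp only [Set.mem_union] at *
    tauto

lemma IsCycleList.isRotated {l l' : List V} (h : G.IsCycleList l) (hr : l.IsRotated l') :
    G.IsCycleList l' := by
  obtain ⟨h1, h2, h3⟩ := h
  refine ⟨?_, hr.nodup_iff.1 h2, hr.perm.length_eq ▸ h3⟩
  rwa [← Cycle.coe_eq_coe.2 hr]

lemma Walk.IsCycle.isCycleList_dropLast {v : V} {C : G.Walk v v} (hC : C.IsCycle) :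
    G.IsCycleList C.support.dropLast := by
  have h3 := hC.three_le_length
  have hn := hC.support_nodup
  have hch := C.isChain_adj_support
  cases C with
  | nil => simp at h3
  | cons h p =>
    obtain ⟨q, hq⟩ : ∃ q, p.support = q ++ [v] :=
      ⟨p.support.dropLast, by
        conv_lhs => rw [← List.dropLast_append_getLast p.support_ne_nil, p.getLast_support]⟩
    have hlen : p.support.length = p.length + 1 := p.length_support
    simp only [Walk.support_cons, hq, List.tail_cons, Walk.length_cons,
      List.length_append, List.length_singleton] at *
    have : (v :: (q ++ [v])).dropLast = v :: q := by
      rw [← List.cons_append, List.dropLast_concat]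
    rw [this]
    refine ⟨hch, ?_, by simp; omega⟩
    rw [List.nodup_append] at hn
    grind

lemma Walk.IsCycle.mem_dropLast_support {v : V} {C : G.Walk v v} (hC : C.IsCycle) {x : V} :
    x ∈ C.support.dropLast ↔ x ∈ C.support := by
  refine ⟨fun h => List.mem_of_mem_dropLast h, fun h => ?_⟩
  have h3 := hC.three_le_length
  cases C with
  | nil => simp at h3
  | cons hadj p =>
    obtain ⟨q, hq⟩ : ∃ q, p.support = q ++ [v] :=
      ⟨p.support.dropLast, by
        conv_lhs => rw [← List.dropLast_append_getLast p.support_ne_nil, p.getLast_support]⟩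
    have : (v :: (q ++ [v])).dropLast = v :: q := by
      rw [← List.cons_append, List.dropLast_concat]
    simp only [Walk.support_cons, hq, this] at *
    grind

lemma IsCycleList.exists_isCycle {l : List V} (h : G.IsCycleList l) :
    ∃ (v : V) (C : G.Walk v v), C.IsCycle ∧ ∀ x, x ∈ C.support ↔ x ∈ l := by
  obtain ⟨h1, h2, h3⟩ := h
  cases l with
  | nil => simp at h3
  | cons v q =>
    rw [Cycle.chain_coe_cons] at h1
    let W : G.Walk v v := (Walk.ofSupport (v :: (q ++ [v])) (by simp) h1).copy rfl (by simp)
    have hW : W.support = v :: (q ++ [v]) :=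
      (Walk.support_copy _ _ _).trans (Walk.support_ofSupport _ _)
    refine ⟨v, W, ?_, fun x => ?_⟩
    · rw [Walk.isCycle_iff_isPath_tail_and_le_length]
      have hlen := W.length_support
      rw [hW] at hlen
      simp at hlen h3
      refine ⟨?_, by omega⟩
      rw [Walk.isPath_def, Walk.support_tail_of_not_nil _ (by
        rw [Walk.not_nil_iff_lt_length]; omega), hW]
      simp only [List.tail_cons, List.nodup_append]
      grind
    · simp only [hW, List.mem_cons, List.mem_append, List.not_mem_nil, or_false]
      tauto

/-- Replacing the segment `A` of a cycle by the detour `P`. -/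
lemma IsCycleList.replace_segment {v w : V} {A P R : List V}
    (h : G.IsCycleList (v :: (A ++ w :: R))) (hP : P ≠ []) (hPn : P.Nodup)
    (hPd : ∀ z ∈ P, z ∉ v :: (A ++ w :: R)) (hch : List.IsChain G.Adj (v :: (P ++ [w]))) :
    G.IsCycleList (v :: (P ++ w :: R)) := by
  obtain ⟨h1, h2, h3⟩ := h
  refine ⟨?_, ?_, ?_⟩
  · rw [Cycle.chain_coe_cons, List.append_assoc, List.cons_append,
      List.isChain_cons_split] at h1 ⊢
    exact ⟨hch, h1.2⟩
  · simp only [List.nodup_cons, List.nodup_append, List.mem_append, List.mem_cons] at *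
    grind
  · have : 0 < P.length := List.length_pos_iff.2 hP
    simp
    omega

/-- Removing the segments `X` and `Y` of a cycle, inserting `P` between `v` and `w`, traversing
the segment from `w` to `a` backwards, and inserting `Q` between `a` and `b`. -/
lemma IsCycleList.cross {v w a b : V} {X M Y R P Q : List V}
    (h : G.IsCycleList (v :: (X ++ a :: (M ++ w :: (Y ++ b :: R)))))
    (hPn : P.Nodup) (hQn : Q.Nodup) (hPQ : P.Disjoint Q)
    (hPd : ∀ z ∈ P, z ∉ v :: (X ++ a :: (M ++ w :: (Y ++ b :: R))))
    (hQd : ∀ z ∈ Q, z ∉ v :: (X ++ a :: (M ++ w :: (Y ++ b :: R))))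
    (hP : List.IsChain G.Adj (v :: (P ++ [w]))) (hQ : List.IsChain G.Adj (a :: (Q ++ [b]))) :
    G.IsCycleList (v :: (P ++ w :: (M.reverse ++ a :: (Q ++ b :: R)))) := by
  obtain ⟨h1, h2, h3⟩ := h
  refine ⟨?_, ?_, ?_⟩
  · rw [Cycle.chain_coe_cons] at *
    simp only [List.append_assoc, List.cons_append] at *
    obtain ⟨-, h1⟩ := List.isChain_cons_split.1 h1
    obtain ⟨h12, h1⟩ := List.isChain_cons_split.1 h1
    obtain ⟨-, h1⟩ := List.isChain_cons_split.1 h1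
    refine List.isChain_cons_split.2 ⟨hP, List.isChain_cons_split.2
      ⟨?_, List.isChain_cons_split.2 ⟨hQ, h1⟩⟩⟩
    have := (List.isChain_reverse (R := G.Adj)).2 (by simpa only [flip, G.adj_comm] using! h12)
    simpa using this
  · simp only [List.nodup_cons, List.nodup_append, List.mem_append, List.mem_cons,
      List.nodup_reverse, List.mem_reverse, List.Disjoint] at *
    grind
  · simp
    omega

lemma _root_.List.exists_first_append {α : Type*} {p : α → Prop} {l : List α} (h : ∃ x ∈ l, p x) :
    ∃ X a M, l = X ++ a :: M ∧ p a ∧ ∀ x ∈ X, ¬ p x := by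
  induction l with
  | nil => simp at h
  | cons c l ih =>
    by_cases hc : p c
    · exact ⟨[], c, l, rfl, hc, by simp⟩
    · obtain ⟨X, a, M, rfl, ha, hX⟩ := ih (by grind)
      exact ⟨c :: X, a, M, rfl, ha, by grind⟩

lemma _root_.List.exists_minimal_prefix {α : Type*} {p : List α → Prop} {l : List α} (h : p l) :
    ∃ A R, l = A ++ R ∧ p A ∧ ∀ X a M, A = X ++ a :: M → ¬ p X := by
  induction hn : l.length using Nat.strong_induction_on generalizing l with
  | _ n ih =>
    by_cases hX : ∃ X a M, l = X ++ a :: M ∧ p X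
    · obtain ⟨X, a, M, rfl, hX⟩ := hX
      obtain ⟨A, R, rfl, hA, hmin⟩ := ih X.length (by simp at hn; omega) hX rfl
      exact ⟨A, R ++ a :: M, by simp, hA, hmin⟩
    · exact ⟨l, [], by simp, h, fun X a M e hp => hX ⟨X, a, M, e, hp⟩⟩

lemma _root_.List.IsRotated.tail_eq {α : Type*} {a : α} {s t : List α}
    (h : (a :: s).IsRotated (a :: t)) (hn : (a :: s).Nodup) : s = t := by
  obtain ⟨n, hr⟩ := h
  rw [← List.rotate_mod] at hr
  have hlt : n % (a :: s).length < (a :: s).length := Nat.mod_lt _ (by simp)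
  have h1 := List.head?_rotate hlt
  rw [hr, List.head?_cons, List.getElem?_eq_getElem hlt, Option.some_inj] at h1
  have h2 : (a :: s)[0] = (a :: s)[n % (a :: s).length] := by simpa using h1
  rw [hn.getElem_inj_iff] at h2
  rw [← h2, List.rotate_zero] at hr
  simpa using hr

lemma _root_.List.IsRotated.exists_eq_append {α : Type*} {v w : α} {A R A' R' : List α}
    (hr : (v :: (A ++ R)).IsRotated (w :: (A' ++ R'))) (hn : (v :: (A ++ R)).Nodup)
    (hvw : v ≠ w) (hw : w ∉ A) (hv : v ∉ A') :
    ∃ R1 R2, R = R1 ++ w :: (A' ++ R2) := by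
  have hwR : w ∈ R := by
    have : w ∈ v :: (A ++ R) := hr.mem_iff.2 (by simp)
    simp only [List.mem_cons, List.mem_append] at this
    grind
  obtain ⟨R1, R2, rfl⟩ := List.append_of_mem hwR
  have h1 : (w :: (A' ++ R')).IsRotated (w :: (R2 ++ v :: (A ++ R1))) := by
    refine hr.symm.trans ?_
    have := List.isRotated_append (l := v :: (A ++ R1)) (l' := w :: R2)
    simpa using this
  have h2 := h1.tail_eq (hr.nodup_iff.1 hn)
  rcases List.append_eq_append_iff.1 h2 with ⟨as, h3, -⟩ | ⟨bs, h3, h4⟩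
  · exact ⟨R1, as, by rw [h3]⟩
  · cases bs with
    | nil => exact ⟨R1, [], by simp_all⟩
    | cons c bs =>
      simp only [List.cons_append, List.cons.injEq] at h4
      exact absurd (by rw [h3, h4.1]; simp) hv

/-- No cycle absorbs a vertex from a component of order at least `m` without creating new
components of order at least `m`. -/
def IsStable (G : SimpleGraph V) (m : ℕ) (l : List V) : Prop :=
  ∀ l', G.IsCycleList l' →
    (∀ z, (G.compIn {x | x ∉ l'} z).ncard < m ∨ G.compIn {x | x ∉ l'} z ⊆ {x | x ∉ l}) →
    ∀ z ∈ l', z ∉ l → (G.compIn {x | x ∉ l} z).ncard < m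

lemma IsStable.le_ncard_attach [Finite V] {m : ℕ} {l A R : List V} {v w x : V}
    (hm : 1 ≤ m) (hs : G.IsStable m l) (hl : G.IsCycleList l)
    (hr : l.IsRotated (v :: (A ++ w :: R)))
    (hx : m ≤ (G.compIn {x | x ∉ l} x).ncard)
    (hv : ∃ p ∈ G.compIn {x | x ∉ l} x, G.Adj v p) (hw : ∃ p ∈ G.compIn {x | x ∉ l} x, G.Adj w p) :
    m ≤ (G.attach {x | x ∉ l} {z | z ∈ A}).ncard := by
  by_contra! hA
  obtain ⟨p, hp, hvp⟩ := hv
  obtain ⟨q, hq, hwq⟩ := hw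
  have hmem : ∀ z, z ∈ l ↔ z ∈ v :: (A ++ w :: R) := fun z => hr.mem_iff
  obtain ⟨P, hP, hPn, hPs, hch⟩ :=
    exists_detour hvp (mem_compIn_trans (mem_compIn_symm hp) hq) hwq.symm
  rw [compIn_eq hp] at hPs
  have hPl : ∀ z ∈ P, z ∉ l := fun z hz => mem_of_mem_compIn (hPs z hz)
  have hcyc := (hl.isRotated hr).replace_segment hP hPn (fun z hz => by
    rw [← hmem]; exact hPl z hz) hch
  obtain ⟨c, P', rfl⟩ := List.exists_cons_of_ne_nil hP
  have := hs _ hcyc (ncard_compIn_lt_or_subset (X := {z | z ∈ A}) (Y := ∅) ?_ (by simp) hA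
    (by rw [attach_empty, Set.ncard_empty]; omega)) c (by simp) (hPl c (by simp))
  · rw [compIn_eq (hPs c (by simp))] at this
    omega
  · intro z hz
    have := hmem z
    clear * - this hz
    simp only [Set.mem_union, Set.mem_ofPred_eq, List.mem_cons, List.mem_append] at *
    tauto

lemma IsStable.not_linkedIn [Finite V] {m : ℕ} {l A R A' R' : List V} {v w x : V}
    (hs : G.IsStable m l) (hl : G.IsCycleList l)
    (hr : l.IsRotated (v :: (A ++ (R ++ w :: (A' ++ R')))))
    (hx : m ≤ (G.compIn {x | x ∉ l} x).ncard)
    (hv : ∃ p ∈ G.compIn {x | x ∉ l} x, G.Adj v p) (hw : ∃ p ∈ G.compIn {x | x ∉ l} x, G.Adj w p)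
    (hAx : ∀ a ∈ A, ∀ p ∈ G.compIn {x | x ∉ l} x, ¬ G.Adj a p)
    (hA : ∀ X a M, A = X ++ a :: M → (G.attach {x | x ∉ l} {z | z ∈ X}).ncard < m)
    (hA' : ∀ X a M, A' = X ++ a :: M → (G.attach {x | x ∉ l} {z | z ∈ X}).ncard < m) :
    ∀ a ∈ A, ∀ b ∈ A', ¬ G.LinkedIn {x | x ∉ l} a b := by
  by_contra! hcon
  obtain ⟨X, a, M, rfl, ⟨b, hb, hab⟩, hX⟩ := List.exists_first_append hcon
  obtain ⟨Y, N, rfl⟩ := List.append_of_mem hb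
  push Not at hX
  obtain ⟨p, hp, hvp⟩ := hv
  obtain ⟨q, hq, hwq⟩ := hw
  have hr' : l.IsRotated (v :: (X ++ a :: ((M ++ R) ++ w :: (Y ++ b :: (N ++ R'))))) := by
    simpa using hr
  have hmem : ∀ z, z ∈ l ↔ _ := fun z => hr'.mem_iff
  obtain ⟨P, hP, hPn, hPs, hch⟩ :=
    exists_detour hvp (mem_compIn_trans (mem_compIn_symm hp) hq) hwq.symm
  rw [compIn_eq hp] at hPs
  have hPl : ∀ z ∈ P, z ∉ l := fun z hz => mem_of_mem_compIn (hPs z hz)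
  obtain ⟨Q, hQn, hQl, hPQ, hQch⟩ : ∃ Q : List V, Q.Nodup ∧ (∀ z ∈ Q, z ∉ l) ∧ P.Disjoint Q ∧
      List.IsChain G.Adj (a :: (Q ++ [b])) := by
    rcases hab with hab | ⟨r, har, s, hs', hsb⟩
    · exact ⟨[], by simp, by simp, by simp, by simpa using hab⟩
    · obtain ⟨Q, -, hQn, hQs, hQch⟩ := exists_detour har hs' hsb
      refine ⟨Q, hQn, fun z hz => mem_of_mem_compIn (hQs z hz), fun z hz hz' => ?_, hQch⟩
      exact hAx a (by simp) r (mem_compIn_trans (hPs z hz) (mem_compIn_symm (hQs z hz'))) har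
  have hcyc := (hl.isRotated hr').cross hPn hQn hPQ (fun z hz => by
    rw [← hmem]; exact hPl z hz) (fun z hz => by rw [← hmem]; exact hQl z hz) hch hQch
  obtain ⟨c, P', rfl⟩ := List.exists_cons_of_ne_nil hP
  have := hs _ hcyc (ncard_compIn_lt_or_subset (X := {z | z ∈ X}) (Y := {z | z ∈ Y}) ?_
    (fun x hx y hy => hX x hx y (by simp at hy ⊢; tauto)) (hA _ _ _ rfl) (hA' _ _ _ rfl))
    c (by simp) (hPl c (by simp))
  · rw [compIn_eq (hPs c (by simp))] at this
    omega
  · intro z hz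
    have := hmem z
    clear * - this hz
    simp only [Set.mem_union, Set.mem_ofPred_eq, List.mem_cons, List.mem_append,
      List.mem_reverse] at *
    grind

lemma IsStable.exists_segment [Finite V] {m : ℕ} {l : List V} {v w x : V}
    (hm : 1 ≤ m) (hs : G.IsStable m l) (hl : G.IsCycleList l)
    (hx : m ≤ (G.compIn {x | x ∉ l} x).ncard) (hvl : v ∈ l) (hwl : w ∈ l) (hvw : v ≠ w)
    (hv : ∃ p ∈ G.compIn {x | x ∉ l} x, G.Adj v p)
    (hw : ∃ p ∈ G.compIn {x | x ∉ l} x, G.Adj w p) :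
    ∃ A R, l.IsRotated (v :: (A ++ R)) ∧
      (∀ a ∈ A, ∀ p ∈ G.compIn {x | x ∉ l} x, ¬ G.Adj a p) ∧
      m ≤ (G.attach {x | x ∉ l} {z | z ∈ A}).ncard ∧
      ∀ X a M, A = X ++ a :: M → (G.attach {x | x ∉ l} {z | z ∈ X}).ncard < m := by
  obtain ⟨L1, L2, rfl⟩ := List.append_of_mem hvl
  have hr : (L1 ++ v :: L2).IsRotated (v :: (L2 ++ L1)) := by
    simpa using List.isRotated_append (l := L1) (l' := v :: L2)
  set l := L1 ++ v :: L2 with hldef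
  have hw' : ∃ w ∈ L2 ++ L1, ∃ p ∈ G.compIn {x | x ∉ l} x, G.Adj w p := by
    refine ⟨w, ?_, hw⟩
    simp [hldef] at hwl ⊢
    grind
  obtain ⟨B, w', R, hB, hw', hBx⟩ := List.exists_first_append hw'
  rw [hB] at hr
  have hB' := hs.le_ncard_attach hm hl hr hx hv hw'
  obtain ⟨A, S, rfl, hA, hmin⟩ := List.exists_minimal_prefix
    (p := fun B => m ≤ (G.attach {x | x ∉ l} {z | z ∈ B}).ncard) hB'
  refine ⟨A, S ++ w' :: R, by simpa using hr, ?_, hA, fun X a M h => by simpa using hmin X a M h⟩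
  intro a ha p hp hap
  exact hBx a (by simp [ha]) ⟨p, hp, hap⟩

lemma compIn_subset_compIn {U' : Set V} (h : G.compIn U' x ⊆ U) :
    G.compIn U' x ⊆ G.compIn U x := by
  classical
  rintro y ⟨p, hp⟩
  exact ⟨p, fun z hz => h ⟨p.takeUntil z hz, fun t ht =>
    hp t (Walk.support_takeUntil_subset_support _ _ ht)⟩⟩

lemma IsCycleList.exists_isStable [Finite V] {m : ℕ} {d : ℝ} {l : List V} (hl : G.IsCycleList l)
    (hd : ∀ x ∉ l, m ≤ (G.compIn {x | x ∉ l} x).ncard → d < ({y | y ∈ l ∧ G.Adj x y}.ncard : ℝ)) :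
    ∃ l, G.IsCycleList l ∧ G.IsStable m l ∧ ∀ x ∉ l, m ≤ (G.compIn {x | x ∉ l} x).ncard →
      d < ({y | y ∈ l ∧ G.Adj x y}.ncard : ℝ) := by
  induction hn : {x | x ∉ l ∧ m ≤ (G.compIn {x | x ∉ l} x).ncard}.ncard
    using Nat.strong_induction_on generalizing l with
  | _ n ih =>
    by_cases hs : G.IsStable m l
    · exact ⟨l, hl, hs, hd⟩
    unfold IsStable at hs
    push Not at hs
    obtain ⟨l', hl', hcomp, z, hzl', hzl, hz⟩ := hs
    have key : ∀ x ∉ l', m ≤ (G.compIn {x | x ∉ l'} x).ncard →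
        G.compIn {x | x ∉ l'} x ⊆ {x | x ∉ l} ∧ x ∉ l ∧
          m ≤ (G.compIn {x | x ∉ l} x).ncard := by
      intro x hx hm
      have h1 := (hcomp x).resolve_left (by omega)
      exact ⟨h1, h1 (mem_compIn_self hx),
        hm.trans (Set.ncard_le_ncard (compIn_subset_compIn h1))⟩
    refine ih _ ?_ hl' ?_ rfl
    · rw [← hn]
      refine Set.ncard_lt_ncard ⟨fun x hx => (key x hx.1 hx.2).2, fun h => ?_⟩
      exact (h ⟨hzl, hz⟩).1 hzl'
    · intro x hx hm
      obtain ⟨h1, h2, h3⟩ := key x hx hm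
      refine (hd x h2 h3).trans_le (Nat.cast_le.2 (Set.ncard_le_ncard ?_))
      rintro y ⟨hy, hxy⟩
      refine ⟨by_contra fun hy' => ?_, hxy⟩
      exact h1 (mem_compIn_of_adj (mem_compIn_self hx) hxy hy') hy

lemma card_le_numComp [Finite V] {ι : Type*} {S : Set V} {D : ι → Set V}
    (hne : ∀ i, (D i).Nonempty) (hDS : ∀ i, ∀ y ∈ D i, y ∉ S)
    (hcl : ∀ i, ∀ y ∈ D i, ∀ z ∉ S, G.Adj y z → z ∈ D i)
    (hdis : ∀ i j, i ≠ j → Disjoint (D i) (D j)) : Nat.card ι ≤ numComp G S := by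
  choose r hr using hne
  refine Nat.card_le_card_of_injective
    (fun i => (G.induce Sᶜ).connectedComponentMk ⟨r i, hDS i _ (hr i)⟩) fun i j hij => ?_
  by_contra hne
  obtain ⟨p⟩ := ConnectedComponent.eq.1 hij
  have key : ∀ {u w : (Sᶜ : Set V)} (p : (G.induce Sᶜ).Walk u w), u.1 ∈ D i → w.1 ∈ D i := by
    intro u w p
    induction p with
    | nil => exact id
    | @cons _ b _ h p ih => exact fun hu => ih (hcl i _ hu _ b.2 h)
  exact Set.disjoint_left.1 (hdis i j hne) (key p (hr i)) (hr j)

lemma two_le_numComp [Finite V] {S H : Set V} (hx : x ∈ H) (hHS : ∀ y ∈ H, y ∉ S)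
    (hcl : ∀ y ∈ H, ∀ z ∉ S, G.Adj y z → z ∈ H) (hzS : z ∉ S) (hzH : z ∉ H) :
    2 ≤ numComp G S := by
  have := card_le_numComp (G := G) (S := S) (D := fun b : Bool => if b then H else (S ∪ H)ᶜ)
    (by
      rintro (_ | _)
      · exact ⟨z, by simp [hzS, hzH]⟩
      · exact ⟨x, hx⟩)
    (by
      rintro (_ | _) y hy
      · simp at hy; exact hy.1
      · exact hHS y hy)
    (by
      rintro (_ | _) y hy w hw hyw
      · simp at hy ⊢
        exact ⟨hw, fun h => hy.2 (hcl w h y hy.1 hyw.symm)⟩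
      · exact hcl y hy w hw hyw)
    (by
      rintro (_ | _) (_ | _) h
      · exact absurd rfl h
      · exact Set.disjoint_left.2 fun y hy hy' => hy (Or.inr hy')
      · exact Set.disjoint_left.2 fun y hy hy' => hy' (Or.inr hy)
      · exact absurd rfl h)
  simpa using this

lemma mul_card_le_ncard [Finite V] {ι : Type*} [Finite ι] {m : ℕ} {W : Set V} {D : ι → Set V}
    (hW : ∀ i, D i ⊆ W) (hm : ∀ i, m ≤ (D i).ncard)
    (hdis : ∀ i j, i ≠ j → Disjoint (D i) (D j)) : m * Nat.card ι ≤ W.ncard := by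
  classical
  have := Fintype.ofFinite ι
  have := Fintype.ofFinite V
  have h1 : ((Finset.univ : Finset ι).biUnion fun i => (D i).toFinset).card =
      ∑ i, (D i).ncard := by
    rw [Finset.card_biUnion fun i _ j _ hij => Set.disjoint_toFinset.2 (hdis i j hij)]
    simp [Set.ncard_eq_toFinset_card']
  rw [Nat.card_eq_fintype_card, mul_comm, ← smul_eq_mul, ← Finset.card_univ]
  refine (Finset.card_nsmul_le_sum _ _ _ fun i _ => hm i).trans ?_
  rw [← h1, Set.ncard_eq_toFinset_card']
  refine Finset.card_le_card fun y hy => ?_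
  simp only [Finset.mem_biUnion, Set.mem_toFinset] at *
  obtain ⟨i, -, hi⟩ := hy
  exact hW i hi

lemma IsCycleList.nontrivial_neighbors [Finite V] {l : List V} (hl : G.IsCycleList l)
    (h2 : ∀ v : V, (G.induce {v}ᶜ).Connected) (hxl : x ∉ l) :
    {v | v ∈ l ∧ ∃ p ∈ G.compIn {x | x ∉ l} x, G.Adj v p}.Nontrivial := by
  by_contra hN
  rw [Set.not_nontrivial_iff] at hN
  obtain ⟨-, hn, h3⟩ := hl
  obtain ⟨v, hvl, hv⟩ : ∃ v ∈ l, ∀ w ∈ l, (∃ p ∈ G.compIn {x | x ∉ l} x, G.Adj w p) → w = v := by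
    rcases hN.eq_empty_or_singleton with h | ⟨v, h⟩
    · refine ⟨l[0], by simp, fun w hw hp => ?_⟩
      exact absurd (show w ∈ {v | v ∈ l ∧ ∃ p ∈ G.compIn {x | x ∉ l} x, G.Adj v p} from ⟨hw, hp⟩)
        (by simp [h])
    · have hv : v ∈ {v | v ∈ l ∧ ∃ p ∈ G.compIn {x | x ∉ l} x, G.Adj v p} := by rw [h]; rfl
      exact ⟨v, hv.1, fun w hw hp => hN ⟨hw, hp⟩ hv⟩
  obtain ⟨w, hwl, hwv⟩ : ∃ w ∈ l, w ≠ v := by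
    by_contra! hcon
    have h01 : l[0] = l[1] := (hcon _ (by simp)).trans (hcon _ (by simp)).symm
    rw [hn.getElem_inj_iff] at h01
    omega
  have := two_le_numComp (G := G) (S := {v}) (H := G.compIn {x | x ∉ l} x) (x := x) (z := w)
    (mem_compIn_self hxl) (fun y hy hyv => mem_of_mem_compIn hy (by rw [hyv]; exact hvl))
    (fun y hy z hz hyz => by
      by_cases hzl : z ∈ l
      · exact absurd (hv z hzl ⟨y, hy, hyz.symm⟩) hz
      · exact mem_compIn_of_adj hy hyz hzl)
    hwv (fun h => mem_of_mem_compIn h hwl)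
  have hsub := (h2 v).preconnected.subsingleton_connectedComponent
  have : numComp G {v} ≤ 1 := Finite.card_le_one_iff_subsingleton.2 hsub
  omega

lemma IsStable.ncard_neighbors_le [Fintype V] {t : ℝ} {m : ℕ} {l : List V} (ht : 0 < t)
    (hm : 1 ≤ m) (h2 : ∀ v : V, (G.induce {v}ᶜ).Connected) (htough : Tough t G)
    (hs : G.IsStable m l) (hl : G.IsCycleList l)
    (hxl : x ∉ l) (hx : m ≤ (G.compIn {x | x ∉ l} x).ncard) :
    ({y | y ∈ l ∧ G.Adj x y}.ncard : ℝ) ≤ (Fintype.card V : ℝ) / (t + 1) - (m : ℝ) := by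
  classical
  have hN2 := hl.nontrivial_neighbors h2 hxl
  set U : Set V := {x | x ∉ l} with hU
  set H := G.compIn U x with hH
  set N : Set V := {v | v ∈ l ∧ ∃ p ∈ H, G.Adj v p} with hN
  have hHl : ∀ y ∈ H, y ∉ l := fun y hy => mem_of_mem_compIn hy
  have hseg : ∀ v : N, ∃ A R, l.IsRotated (v.1 :: (A ++ R)) ∧
      (∀ a ∈ A, ∀ p ∈ H, ¬ G.Adj a p) ∧ m ≤ (G.attach U {z | z ∈ A}).ncard ∧
      ∀ X a M, A = X ++ a :: M → (G.attach U {z | z ∈ X}).ncard < m := by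
    intro v
    obtain ⟨w, hw, hwv⟩ := hN2.exists_ne v.1
    exact hs.exists_segment hm hl hx v.2.1 hw.1 hwv.symm v.2.2 hw.2
  choose A R hr hAx hAm hAmin using hseg
  have hAl : ∀ v, ∀ a ∈ A v, a ∈ l := fun v a ha => (hr v).mem_iff.2 (by simp [ha])
  have hAN : ∀ v, ∀ a ∈ A v, a ∉ N := fun v a ha haN => by
    obtain ⟨-, p, hp, hap⟩ := haN
    exact hAx v a ha p hp hap
  have happ : ∀ v w : N, v ≠ w → ∃ R1 R2, R v = R1 ++ w.1 :: (A w ++ R2) := fun v w hvw =>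
    List.IsRotated.exists_eq_append ((hr v).symm.trans (hr w)) ((hr v).nodup_iff.1 hl.2.1)
      (fun h => hvw (Subtype.ext h)) (fun h => hAN v _ h w.2) (fun h => hAN w _ h v.2)
  have hlink : ∀ v w : N, v ≠ w → ∀ a ∈ A v, ∀ b ∈ A w, ¬ G.LinkedIn U a b := by
    intro v w hvw
    obtain ⟨R1, R2, hR⟩ := happ v w hvw
    have hrv := hr v
    rw [hR] at hrv
    exact hs.not_linkedIn hl hrv hx v.2.2 w.2.2 (hAx v) (hAmin v) (hAmin w)
  have hAdisj : ∀ v w : N, v ≠ w → Disjoint {z | z ∈ A v} {z | z ∈ A w} := by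
    intro v w hvw
    obtain ⟨R1, R2, hR⟩ := happ v w hvw
    have hn := (hr v).nodup_iff.1 hl.2.1
    rw [hR] at hn
    rw [Set.disjoint_left]
    intro z hz hz'
    simp only [List.nodup_cons, List.nodup_append, List.mem_append, List.mem_cons,
      Set.mem_ofPred_eq] at *
    grind
  have hAU : ∀ v, Disjoint {z | z ∈ A v} U := fun v =>
    Set.disjoint_left.2 fun z hz hz' => hz' (hAl v z hz)
  have hHA : ∀ v, Disjoint H (G.attach U {z | z ∈ A v}) := by
    refine fun v => Set.disjoint_left.2 ?_
    rintro y hy (h | ⟨a, ha, q, haq, hyq⟩)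
    · exact hHl y hy (hAl v y h)
    · exact hAx v a ha q (mem_compIn_trans hy (mem_compIn_symm hyq)) haq
  let D : Option N → Set V := fun o => o.elim H fun v => G.attach U {z | z ∈ A v}
  let W : Set V := U ∪ ⋃ v, {z | z ∈ A v}
  have hDm : ∀ i, m ≤ (D i).ncard := by
    rintro (_ | v)
    · exact hx
    · exact hAm v
  have hDW : ∀ i, D i ⊆ W := by
    rintro (_ | v) y hy
    · exact Or.inl (mem_of_mem_compIn hy)
    · rcases hy with hy | ⟨a, ha, q, haq, hyq⟩
      · exact Or.inr (Set.mem_iUnion.2 ⟨v, hy⟩)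
      · exact Or.inl (mem_of_mem_compIn hyq)
  have hDdis : ∀ i j, i ≠ j → Disjoint (D i) (D j) := by
    rintro (_ | v) (_ | w) h
    · exact absurd rfl h
    · exact hHA w
    · exact (hHA v).symm
    · have hvw : v ≠ w := fun e => h (by rw [e])
      exact disjoint_attach (hAdisj v w hvw) (hAU v) (hAU w) (hlink v w hvw)
  have hDcl : ∀ i, ∀ y ∈ D i, ∀ z ∈ W, G.Adj y z → z ∈ D i := by
    rintro (_ | v) y hy z hz hyz
    · rcases hz with hz | hz
      · exact mem_compIn_of_adj hy hyz hz
      · obtain ⟨v, hz⟩ := Set.mem_iUnion.1 hz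
        exact absurd hyz.symm (hAx v z hz y hy)
    · rcases hz with hz | hz
      · exact mem_attach_of_adj hy hyz hz
      · obtain ⟨w, hz⟩ := Set.mem_iUnion.1 hz
        by_cases hvw : v = w
        · subst hvw; exact Or.inl hz
        · obtain ⟨a, ha, hl'⟩ := exists_linkedIn_of_mem_attach hy hyz
          exact absurd hl' (hlink v w hvw a ha z hz)
  have hcardι : Nat.card (Option N) = N.ncard + 1 := by
    rw [Finite.card_option, Nat.card_coe_set_eq]
  have hWcard := mul_card_le_ncard hDW hDm hDdis
  have hcomp : Nat.card (Option N) ≤ numComp G (Wᶜ.toFinset : Set V) := by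
    rw [Set.coe_toFinset]
    refine card_le_numComp (D := D) (fun i => ?_) (fun i y hy h => h (hDW i hy))
      (fun i y hy z hz => hDcl i y hy z (not_not.1 hz)) hDdis
    exact Set.nonempty_of_ncard_ne_zero (by have := hDm i; omega)
  have hk2 : 2 ≤ N.ncard := by
    have := (Set.one_lt_ncard_iff_nontrivial).2 hN2
    omega
  rw [hcardι] at hWcard hcomp
  have hT1 := htough Wᶜ.toFinset (by omega)
  have hScard : Wᶜ.toFinset.card + W.ncard = Fintype.card V := by
    rw [← Set.ncard_eq_toFinset_card', add_comm, Set.ncard_add_ncard_compl,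
      Nat.card_eq_fintype_card]
  have hNcomp : 2 ≤ numComp G (N.toFinset : Set V) := by
    rw [Set.coe_toFinset]
    obtain ⟨v, hv⟩ := hN2.nonempty
    have hAne : A ⟨v, hv⟩ ≠ [] := fun h => by
      have := hAm ⟨v, hv⟩
      simp [h, attach_empty] at this
      omega
    obtain ⟨a, ha⟩ := List.exists_mem_of_ne_nil _ hAne
    refine two_le_numComp (H := H) (x := x) (z := a) (mem_compIn_self hxl)
      (fun y hy h => hHl y hy h.1) (fun y hy z hz hyz => ?_) (hAN _ a ha)
      (fun h => hHl a h (hAl _ a ha))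
    by_cases hzl : z ∈ l
    · exact absurd ⟨hzl, y, hy, hyz.symm⟩ hz
    · exact mem_compIn_of_adj hy hyz hzl
  have hT2 := htough N.toFinset hNcomp
  rw [← Set.ncard_eq_toFinset_card'] at hT2
  have hdeg : {y | y ∈ l ∧ G.Adj x y}.ncard ≤ N.ncard :=
    Set.ncard_le_ncard fun y hy => ⟨hy.1, x, mem_compIn_self hxl, hy.2.symm⟩
  have e1 : ((N.ncard : ℝ) + 1) ≤ numComp G (Wᶜ.toFinset : Set V) := by exact_mod_cast hcomp
  have e2 : (2 : ℝ) ≤ numComp G (N.toFinset : Set V) := by exact_mod_cast hNcomp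
  have e3 : (m : ℝ) * (N.ncard + 1) ≤ W.ncard := by exact_mod_cast hWcard
  have e4 : (Wᶜ.toFinset.card : ℝ) + W.ncard = Fintype.card V := by exact_mod_cast hScard
  have e5 : ({y | y ∈ l ∧ G.Adj x y}.ncard : ℝ) ≤ N.ncard := by exact_mod_cast hdeg
  have e6 : (1 : ℝ) ≤ m := by exact_mod_cast hm
  have f1 := mul_le_mul_of_nonneg_left e1 ht.le
  have f2 := mul_le_mul_of_nonneg_left e2 ht.le
  have f3 : 0 ≤ ((m : ℝ) - 1) * (N.ncard - t) := mul_nonneg (by linarith) (by linarith)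
  have f4 : (N.ncard : ℝ) + m ≤ (Fintype.card V : ℝ) / (t + 1) := by
    rw [le_div_iff₀ (by linarith)]
    linarith
  linarith

lemma image_supp_connectedComponentMk {S : Set V} (hx : x ∈ S) :
    Subtype.val '' ((G.induce S).connectedComponentMk ⟨x, hx⟩).supp = G.compIn S x := by
  ext y
  constructor
  · rintro ⟨⟨y, hy⟩, hc, rfl⟩
    rw [ConnectedComponent.mem_supp_iff, ConnectedComponent.eq] at hc
    obtain ⟨p⟩ := hc.symm
    refine ⟨p.map (Embedding.induce S).toHom, fun z hz => ?_⟩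
    erw [Walk.support_map] at hz
    obtain ⟨w, -, rfl⟩ := List.mem_map.1 hz
    exact w.2
  · rintro ⟨p, hp⟩
    refine ⟨⟨y, hp _ p.end_mem_support⟩, ?_, rfl⟩
    rw [ConnectedComponent.mem_supp_iff, ConnectedComponent.eq]
    exact ⟨(p.induce S hp).reverse⟩

lemma card_supp_connectedComponentMk {S : Set V} (hx : x ∈ S) :
    Nat.card ((G.induce S).connectedComponentMk ⟨x, hx⟩).supp = (G.compIn S x).ncard := by
  rw [← image_supp_connectedComponentMk hx, Set.ncard_image_of_injective _ Subtype.val_injective,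
    Nat.card_coe_set_eq]

end SimpleGraph

/-- **Key lemma.** Let `G` be a `2`-connected `t`-tough graph of order `n` with a
`D_{λ+1}`-cycle but no `D_λ`-cycle, and let `C` be a cycle such that each component of
`G − V(C)` has at most `λ−1` vertices or is a path with at least `λ` vertices. Then some
path-component of `G − V(C)` with at least `λ` vertices contains a vertex `x` with
`deg_G(x, C) ≤ n/(t+1) − λ`. -/
theorem stmt5 {V : Type*} [Fintype V] (t : ℝ) (ht : 0 < t) (G : SimpleGraph V)
    (h2conn : 3 ≤ Fintype.card V ∧ ∀ v : V, (G.induce {v}ᶜ).Connected)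
    (htough : Tough t G) (lam : ℕ) (hlam : 1 ≤ lam)
    (hDlam1 : ∃ (w : V) (C' : G.Walk w w), IsDCycle G C' (lam + 1))
    (hnoDlam : ∀ (w : V) (C' : G.Walk w w), ¬ IsDCycle G C' lam)
    (v : V) (C : G.Walk v v) (hC : C.IsCycle)
    (hcomps : ∀ c : (G.induce {x : V | x ∈ C.support}ᶜ).ConnectedComponent,
      Nat.card c.supp ≤ lam - 1 ∨
        (lam ≤ Nat.card c.supp ∧ IsPathComponent G {x : V | x ∈ C.support} c)) :
    ∃ c : (G.induce {x : V | x ∈ C.support}ᶜ).ConnectedComponent,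
      lam ≤ Nat.card c.supp ∧ IsPathComponent G {x : V | x ∈ C.support} c ∧
        ∃ x ∈ Subtype.val '' c.supp,
          ((Nat.card {y : V | y ∈ C.support ∧ G.Adj x y} : ℕ) : ℝ) ≤
            (Fintype.card V : ℝ) / (t + 1) - (lam : ℝ) := by
  by_contra! hcon
  have hmem : ∀ x, x ∈ C.support.dropLast ↔ x ∈ C.support := fun x => hC.mem_dropLast_support
  have hset : {x | x ∉ C.support.dropLast} = {x | x ∈ C.support}ᶜ := by
    ext x; simp [hmem]
  obtain ⟨l, hl, hs, hd⟩ := hC.isCycleList_dropLast.exists_isStable (m := lam)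
    (d := (Fintype.card V : ℝ) / (t + 1) - lam) (by
      intro x hx hm
      rw [hset] at hm
      have hx' : x ∈ {x | x ∈ C.support}ᶜ := fun h => hx ((hmem x).2 h)
      rw [← card_supp_connectedComponentMk hx'] at hm
      have hpath := (hcomps _).resolve_left (show ¬ _ by
        intro h
        exact absurd (hm.trans h) (by omega))
      have := hcon _ hm hpath.2 x ⟨_, ConnectedComponent.connectedComponentMk_mem, rfl⟩
      rw [Nat.card_coe_set_eq] at this
      simpa only [hmem] using this)
  obtain ⟨w, C', hC', hmem'⟩ := hl.exists_isCycle
  have hset' : {x | x ∉ l} = {x | x ∈ C'.support}ᶜ := by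
    ext x; simp [hmem']
  refine hnoDlam w C' ⟨hC', fun c => ?_⟩
  by_contra! hc
  induction c using ConnectedComponent.ind with
  | _ x =>
    obtain ⟨x, hx⟩ := x
    rw [card_supp_connectedComponentMk hx, ← hset'] at hc
    have hxl : x ∉ l := fun h => hx ((hmem' x).2 h)
    exact absurd (hd x hxl hc) (not_lt.2 (hs.ncard_neighbors_le ht hlam h2conn.2 htough hl hxl hc))
end
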